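/- For every n ≥ 1, if x ∈ Lie(n) lies in the descent subspace, i.e., x is a linear combination of the elements D_E = Σ_{σ∈S_n, Des(σ)=E} σ over subsets E ⊆ {1,…,n−1}, then x is a linear combination of the LR-class sums Σ_{t∈C} c_t, where C ranges over LR-classes of binary trees with n−1 nodes. -/

import Mathlib

/-- The free module on words of positive integers, with coefficients in `R`.
`ℚ[S_n]` is identified with the span of the permutation words of {1,…,n}. -/
abbrev FW (R : Type) [CommRing R] := (List ℕ) →₀ R

variable {R : Type} [CommRing R]

/-- Concatenation product, extended bilinearly. -/
noncomputable def catW (x y : FW R) : FW R :=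
  x.sum fun u a => y.sum fun v b => Finsupp.single (u ++ v) (a * b)

/-- The bracket [x,y] = x·y − y·x of the concatenation product. -/
noncomputable def brakW (x y : FW R) : FW R := catW x y - catW y x

/-- (Incomplete) binary trees; `nil` is the empty tree. The complete binary tree with
`t.nodes + 1` leaves whose internal nodes form `t` is implicit in the definitions below. -/
inductive BT
  | nil : BT
  | nd : BT → BT → BT
deriving DecidableEq

/-- Number of nodes of a binary tree. -/
def BT.nodes : BT → ℕ
  | .nil => 0
  | .nd l r => l.nodes + r.nodes + 1

/-- The evaluation T(σ) of the complete binary tree `T` whose internal nodes form `t`, with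
leaves labelled left to right by the word `w`: each leaf gets the one-letter word of its label
and each internal node the bracket of concatenation. -/
noncomputable def evalBT : BT → List ℕ → FW R
  | .nil, w => Finsupp.single w 1
  | .nd l r, w => brakW (evalBT l (w.take (l.nodes + 1))) (evalBT r (w.drop (l.nodes + 1)))

/-- The standardization of a word with distinct letters: each letter is replaced by its rank. -/
def stdW (w : List ℕ) : List ℕ := w.map fun x => (w.filter (· ≤ x)).length

/-- The set of permutation words of {1, …, n}. -/
def permWords (n : ℕ) : Finset (List ℕ) := (List.range' 1 n).permutations.toFinset

/-- Convolution α⋆β of two permutation words: the sum of all permutation words γ of size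
|α|+|β| with std(γ(1)⋯γ(m)) = α and std(γ(m+1)⋯γ(m+n)) = β. -/
noncomputable def convW (u v : List ℕ) : FW R :=
  ∑ γ ∈ (permWords (u.length + v.length)).filter
      (fun γ => stdW (γ.take u.length) = u ∧ stdW (γ.drop u.length) = v),
    Finsupp.single γ 1

/-- The convolution product, extended bilinearly. -/
noncomputable def starW (x y : FW R) : FW R :=
  x.sum fun u a => y.sum fun v b => (a * b) • convW u v

/-- Whether the word `w` is an admissible labelling of (the completion of) `t`: at each internal
node, the smallest label lies in the left subtree and the largest in the right subtree. -/
def admB : BT → List ℕ → Bool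
  | .nil, _ => true
  | .nd l r, w =>
    admB l (w.take (l.nodes + 1)) && admB r (w.drop (l.nodes + 1))
      && decide ((w.take (l.nodes + 1)).minimum = w.minimum)
      && decide ((w.drop (l.nodes + 1)).maximum = w.maximum)

/-- c_t: the sum of the evaluations T(σ) over all admissible labellings σ of the complete
binary tree whose internal nodes form `t`. -/
noncomputable def cElt (t : BT) : FW R :=
  ∑ w ∈ (permWords (t.nodes + 1)).filter (fun w => admB t w = true), evalBT t w


/-- The finite set of all binary trees with m nodes. -/
def allBT : ℕ → Finset BT
  | 0 => {BT.nil}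
  | m + 1 =>
    (Finset.range (m + 1)).attach.biUnion fun k =>
      ((allBT k.1) ×ˢ (allBT (m - k.1))).image fun p => BT.nd p.1 p.2
decreasing_by
  · exact k.2 |> Finset.mem_range.mp
  · omega

mutual
/-- `LIn t t'`: `t'` is obtained from `t` by an L-move at a vertex `v` of `t` that is the root
of `t` or a right child of its parent: `v` has a right child `w`, and the left subtree of `v`
is exchanged with the left subtree of `w`. (The root of the ambient subtree qualifies.) -/
inductive LIn : BT → BT → Prop
  | here (t1 t2 t3 : BT) : LIn (BT.nd t1 (BT.nd t2 t3)) (BT.nd t2 (BT.nd t1 t3))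
  | congL {l l' : BT} (r : BT) : LSub l l' → LIn (BT.nd l r) (BT.nd l' r)
  | congR (l : BT) {r r' : BT} : LIn r r' → LIn (BT.nd l r) (BT.nd l r')

/-- `LSub t t'`: `t'` is obtained from `t` by an L-move at a vertex that is a right child of
its parent (the root of the ambient subtree itself does not qualify). -/
inductive LSub : BT → BT → Prop
  | congL {l l' : BT} (r : BT) : LSub l l' → LSub (BT.nd l r) (BT.nd l' r)
  | congR (l : BT) {r r' : BT} : LIn r r' → LSub (BT.nd l r) (BT.nd l r')
end

/-- L-equivalence: the equivalence relation on binary trees generated by L-moves. -/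
def LEquiv : BT → BT → Prop := Relation.EqvGen LIn

mutual
/-- `RIn t t'`: `t'` is obtained from `t` by an R-move at a vertex `v` of `t` that is the root
of `t` or a left child of its parent: `v` has a left child `w`, and the right subtree of `v`
is exchanged with the right subtree of `w`. (The root of the ambient subtree qualifies.) -/
inductive RIn : BT → BT → Prop
  | here (t1 t2 t3 : BT) : RIn (BT.nd (BT.nd t3 t2) t1) (BT.nd (BT.nd t3 t1) t2)
  | congL {l l' : BT} (r : BT) : RIn l l' → RIn (BT.nd l r) (BT.nd l' r)
  | congR (l : BT) {r r' : BT} : RSub r r' → RIn (BT.nd l r) (BT.nd l r')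

/-- `RSub t t'`: `t'` is obtained from `t` by an R-move at a vertex that is a left child of its
parent (the root of the ambient subtree itself does not qualify). -/
inductive RSub : BT → BT → Prop
  | congL {l l' : BT} (r : BT) : RIn l l' → RSub (BT.nd l r) (BT.nd l' r)
  | congR (l : BT) {r r' : BT} : RSub r r' → RSub (BT.nd l r) (BT.nd l r')
end

/-- LR-equivalence: the equivalence relation generated by L-moves and R-moves. -/
def LREquiv : BT → BT → Prop := Relation.EqvGen fun t t' => LIn t t' ∨ RIn t t'

/-- Lie(n): the linear span of the evaluations T(σ) over all complete binary trees with n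
leaves and all permutations σ ∈ S_n. -/
noncomputable def LieN (n : ℕ) : Submodule ℚ (FW ℚ) :=
  Submodule.span ℚ {x | ∃ t : BT, ∃ w ∈ permWords n, t.nodes + 1 = n ∧ x = evalBT t w}

/-- The descent set Des(w) = {i ∈ {1,…,|w|−1} : w(i) > w(i+1)} of a word (1-based). -/
def desSet (w : List ℕ) : Finset ℕ :=
  (Finset.Icc 1 (w.length - 1)).filter fun i => w.getD i 0 < w.getD (i - 1) 0

/-- The descent-class element D_E = Σ_{σ ∈ S_n, Des(σ) = E} σ. -/
noncomputable def DE (n : ℕ) (E : Finset ℕ) : FW ℚ :=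
  ∑ σ ∈ (permWords n).filter (fun σ => desSet σ = E), Finsupp.single σ (1 : ℚ)

open scoped Classical in
/-- The sum Σ_{s ∈ C} c_s over the LR-class C of the tree t. -/
noncomputable def LRclassSum (t : BT) : FW ℚ :=
  ∑ s ∈ (allBT t.nodes).filter (fun s => LREquiv t s), cElt s

/-! ### Shuffles of words -/

/-- The list of all shuffles of two words. -/
def sh : List ℕ → List ℕ → List (List ℕ)
  | [], v => [v]
  | a :: u, [] => [a :: u]
  | a :: u, b :: v => (sh u (b :: v)).map (a :: ·) ++ (sh (a :: u) v).map (b :: ·)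
termination_by u v => u.length + v.length

/-- The sum of the values of `f` over all shuffles of `u` and `v`. -/
def shSum {M : Type*} [AddCommMonoid M] (f : List ℕ → M) (u v : List ℕ) : M :=
  ((sh u v).map f).sum

section shuffle

variable {M N : Type*} [AddCommGroup M] [AddCommGroup N]

@[simp] lemma shSum_nil_left (f : List ℕ → M) (v : List ℕ) : shSum f [] v = f v := by
  simp [shSum, sh]

@[simp] lemma shSum_nil_right (f : List ℕ → M) (u : List ℕ) : shSum f u [] = f u := by
  cases u <;> simp [shSum, sh]

lemma shSum_cons_cons (f : List ℕ → M) (a b : ℕ) (u v : List ℕ) :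
    shSum f (a :: u) (b :: v)
      = shSum (fun w => f (a :: w)) u (b :: v) + shSum (fun w => f (b :: w)) (a :: u) v := by
  simp only [shSum]
  rw [sh]
  simp [List.map_append, Function.comp_def]

/-- Induction along the recursion defining shuffles. -/
lemma sh_induction {P : List ℕ → List ℕ → Prop} (hl : ∀ v, P [] v) (hr : ∀ u, P u [])
    (h : ∀ a u b v, P u (b :: v) → P (a :: u) v → P (a :: u) (b :: v)) (u v : List ℕ) : P u v := by
  induction u generalizing v with
  | nil => exact hl v
  | cons a u ih =>
    induction v with
    | nil => exact hr _
    | cons b v ihv => exact h a u b v (ih _) ihv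

lemma perm_of_mem_sh {u v w : List ℕ} (h : w ∈ sh u v) : w.Perm (u ++ v) := by
  induction u, v using sh_induction generalizing w with
  | hl v => simp [sh] at h; simp [h]
  | hr u => cases u <;> simp [sh] at h <;> simp [h]
  | h a u b v h1 h2 =>
    rw [sh] at h
    simp only [List.mem_append, List.mem_map] at h
    rcases h with ⟨w, hw, rfl⟩ | ⟨w, hw, rfl⟩
    · exact (h1 hw).cons a
    · exact ((h2 hw).cons b).trans (List.perm_middle (l₁ := a :: u)).symm

lemma shSum_congr {f g : List ℕ → M} {u v : List ℕ}
    (h : ∀ w, w.Perm (u ++ v) → f w = g w) : shSum f u v = shSum g u v := by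
  unfold shSum
  congr 1
  exact List.map_congr_left fun w hw => h w (perm_of_mem_sh hw)

lemma shSum_eq_zero {f : List ℕ → M} {u v : List ℕ}
    (h : ∀ w, w.Perm (u ++ v) → f w = 0) : shSum f u v = 0 := by
  rw [shSum_congr h]
  simp [shSum]

lemma shSum_map (L : M →+ N) (f : List ℕ → M) (u v : List ℕ) :
    shSum (fun w => L (f w)) u v = L (shSum f u v) := by
  simp [shSum, map_list_sum, Function.comp_def]

lemma shSum_add (f g : List ℕ → M) (u v : List ℕ) :
    shSum (fun w => f w + g w) u v = shSum f u v + shSum g u v := by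
  simp [shSum, List.sum_map_add]

lemma shSum_sub (f g : List ℕ → M) (u v : List ℕ) :
    shSum (fun w => f w - g w) u v = shSum f u v - shSum g u v := by
  have := shSum_add (fun w => f w - g w) g u v
  simp only [sub_add_cancel] at this
  rw [this, add_sub_cancel_right]

lemma shSum_sum {ι : Type*} (s : Finset ι) (f : ι → List ℕ → M) (u v : List ℕ) :
    shSum (fun w => ∑ i ∈ s, f i w) u v = ∑ i ∈ s, shSum (f i) u v := by
  classical
  induction s using Finset.induction_on with
  | empty => exact shSum_eq_zero fun _ _ => by simp
  | insert i s hi ih => simp only [Finset.sum_insert hi, shSum_add, ih]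

lemma shSum_comm (f : List ℕ → M) (u v : List ℕ) : shSum f u v = shSum f v u := by
  induction u, v using sh_induction generalizing f with
  | hl v => simp
  | hr u => simp
  | h a u b v h1 h2 => rw [shSum_cons_cons, shSum_cons_cons, h1, h2, add_comm]

lemma shSum_snoc_snoc (f : List ℕ → M) (a b : ℕ) (u v : List ℕ) :
    shSum f (u ++ [a]) (v ++ [b])
      = shSum (fun w => f (w ++ [a])) u (v ++ [b]) + shSum (fun w => f (w ++ [b])) (u ++ [a]) v := by
  induction u, v using sh_induction generalizing f with
  | hl v =>
    induction v generalizing f with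
    | nil => simp [shSum_cons_cons, add_comm]
    | cons c v ih =>
      have := ih (fun w => f (c :: w))
      simp only [List.nil_append, shSum_nil_left] at this
      simp [shSum_cons_cons, this]
      abel
  | hr u =>
    induction u generalizing f with
    | nil => simp [shSum_cons_cons, add_comm]
    | cons c u ih =>
      have := ih (fun w => f (c :: w))
      simp only [List.nil_append, shSum_nil_right] at this
      simp [shSum_cons_cons, this]
      abel
  | h c u d v h1 h2 =>
    simp only [List.cons_append] at h1 h2 ⊢
    rw [shSum_cons_cons, h1, h2, shSum_cons_cons, shSum_cons_cons]
    simp only [List.cons_append]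
    abel

lemma shSum_reverse (f : List ℕ → M) (u v : List ℕ) :
    shSum (fun w => f w.reverse) u v = shSum f u.reverse v.reverse := by
  induction u, v using sh_induction generalizing f with
  | hl v => simp
  | hr u => simp
  | h a u b v h1 h2 =>
    have e1 := h1 (fun w => f (w ++ [a]))
    have e2 := h2 (fun w => f (w ++ [b]))
    simp only [List.reverse_cons] at e1 e2 ⊢
    rw [shSum_cons_cons, shSum_snoc_snoc]
    simp only [List.reverse_cons, e1, e2]

/-- Splitting the shuffles of `b :: u` and `v` at the position of `b`. -/
lemma shSum_cons_eq_zero {b : ℕ} {h : List ℕ → M} {L : List ℕ}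
    (H : ∀ u v : List ℕ, L.Perm (b :: u ++ v) → shSum h (b :: u) v = 0) :
    ∀ v u : List ℕ, L.Perm (v ++ b :: u) → h (v ++ b :: u) = 0 := by
  have key : ∀ (v u : List ℕ) (f : List ℕ → M),
      (∀ v₁ w : List ℕ, v₁.length < v.length → (v₁ ++ b :: w).Perm (b :: u ++ v) →
        f (v₁ ++ b :: w) = 0) → shSum f (b :: u) v = f (v ++ b :: u) := by
    intro v
    induction v with
    | nil => intro u f _; simp
    | cons c v ih =>
      intro u f hf
      rw [shSum_cons_cons, ih u (fun w => f (c :: w)), shSum_eq_zero, zero_add]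
      · rfl
      · intro w hw
        exact hf [] w (by simp) (hw.cons b)
      · intro v₁ w hl hp
        refine hf (c :: v₁) w (by simpa using hl) ?_
        exact (hp.cons c).trans (List.perm_middle (l₁ := b :: u)).symm
  intro v
  induction hn : v.length using Nat.strong_induction_on generalizing v with
  | _ n ih =>
    intro u hL
    have hL' : L.Perm (b :: u ++ v) :=
      hL.trans (List.perm_append_comm (l₁ := v) (l₂ := b :: u))
    rw [← key v u h, H u v hL']
    intro v₁ w hl hp
    exact ih _ (hn ▸ hl) v₁ rfl w (hL'.trans hp.symm)

/-- The mirror image of `shSum_cons_eq_zero`. -/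
lemma shSum_snoc_eq_zero {a : ℕ} {h : List ℕ → M} {L : List ℕ}
    (H : ∀ u v : List ℕ, L.Perm (u ++ (v ++ [a])) → shSum h u (v ++ [a]) = 0) :
    ∀ v u : List ℕ, L.Perm (v ++ a :: u) → h (v ++ a :: u) = 0 := by
  intro v u hL
  have := shSum_cons_eq_zero (b := a) (h := fun w => h w.reverse) (L := L) ?_ u.reverse v.reverse ?_
  · simpa using this
  · intro u v hp
    rw [shSum_reverse, shSum_comm, List.reverse_cons]
    apply H
    refine hp.trans ?_
    refine List.perm_append_comm.trans ?_
    refine List.Perm.append (List.reverse_perm v).symm ?_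
    exact ((List.reverse_perm u).symm.cons a).trans (List.perm_append_singleton a _).symm
  · refine hL.trans ?_
    refine List.perm_middle.trans ?_
    refine List.Perm.trans ?_ List.perm_middle.symm
    refine List.Perm.cons a (List.perm_append_comm.trans ?_)
    exact List.Perm.append (List.reverse_perm u).symm (List.reverse_perm v).symm

end shuffle

/-! ### Deconcatenation and Lie functions -/

/-- The sum of `f u * g v` over all factorizations `w = u ++ v`. -/
def conv (f g : List ℕ → ℚ) : List ℕ → ℚ
  | [] => f [] * g []
  | a :: w => f [] * g (a :: w) + conv (fun u => f (a :: u)) g w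

section conv

variable (f f' g g' : List ℕ → ℚ)

lemma conv_add_left (w : List ℕ) :
    conv (fun u => f u + f' u) g w = conv f g w + conv f' g w := by
  induction w generalizing f f' with
  | nil => simp [conv, add_mul]
  | cons a w ih => simp only [conv, ih]; ring

lemma conv_smul_left (c : ℚ) (w : List ℕ) :
    conv (fun u => c * f u) g w = c * conv f g w := by
  induction w generalizing f with
  | nil => simp [conv, mul_assoc]
  | cons a w ih => simp only [conv, ih]; ring

lemma conv_add_right (w : List ℕ) :
    conv f (fun u => g u + g' u) w = conv f g w + conv f g' w := by
  induction w generalizing f with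
  | nil => simp [conv, mul_add]
  | cons a w ih => simp only [conv, ih]; ring

variable {f f' g g'} in
lemma conv_congr {w : List ℕ} (h : ∀ u v, u ++ v = w → f u * g v = f' u * g' v) :
    conv f g w = conv f' g' w := by
  induction w generalizing f f' with
  | nil => exact h [] [] rfl
  | cons a w ih =>
    simp only [conv]
    rw [h [] (a :: w) rfl, ih]
    intro u v e
    exact h (a :: u) v (by simp [e])

lemma conv_eq_zero {w : List ℕ} (h : ∀ u v, u ++ v = w → f u * g v = 0) : conv f g w = 0 := by
  induction w generalizing f with
  | nil => exact h [] [] rfl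
  | cons a w ih =>
    simp only [conv]
    rw [h [] (a :: w) rfl, ih, add_zero]
    intro u v e
    exact h (a :: u) v (by simp [e])

/-- Only one factorization contributes. -/
lemma conv_append {u v : List ℕ}
    (h : ∀ u' v', u' ++ v' = u ++ v → u'.length ≠ u.length → f u' * g v' = 0) :
    conv f g (u ++ v) = f u * g v := by
  induction u generalizing f with
  | nil =>
    cases v with
    | nil => simp [conv]
    | cons b v =>
      simp only [List.nil_append, conv]
      rw [conv_eq_zero, add_zero]
      intro u' v' e
      exact h (b :: u') v' (by simp [e]) (by simp)
  | cons a u ih =>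
    simp only [List.cons_append, conv]
    rw [h [] (a :: (u ++ v)) rfl (by simp), zero_add, ih]
    intro u' v' e hl
    exact h (a :: u') v' (by simp [e]) (by simpa using hl)

lemma conv_assoc (h : List ℕ → ℚ) (w : List ℕ) :
    conv (conv f g) h w = conv f (conv g h) w := by
  induction w generalizing f with
  | nil => simp [conv, mul_assoc]
  | cons a w ih =>
    simp only [conv]
    rw [conv_add_left, conv_smul_left, ih]
    ring

lemma conv_snoc (a : ℕ) (w : List ℕ) :
    conv f g (w ++ [a]) = conv f (fun v => g (v ++ [a])) w + f (w ++ [a]) * g [] := by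
  induction w generalizing f with
  | nil => simp [conv]
  | cons b w ih => simp only [List.cons_append, conv, ih]; ring

lemma conv_reverse (w : List ℕ) :
    conv f g w.reverse = conv (fun v => g v.reverse) (fun u => f u.reverse) w := by
  induction w generalizing g with
  | nil => simp [conv, mul_comm]
  | cons a w ih =>
    rw [List.reverse_cons, conv_snoc, ih]
    simp [conv]
    ring

lemma inits_zip_tails_cons (a : ℕ) (u : List ℕ) : (a :: u).inits.zip (a :: u).tails
    = ([], a :: u) :: (u.inits.zip u.tails).map fun p => (a :: p.1, p.2) := by
  simp [List.zip_map_left]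

lemma conv_eq_sum_zip (w : List ℕ) :
    conv f g w = ((w.inits.zip w.tails).map fun p => f p.1 * g p.2).sum := by
  induction w generalizing f with
  | nil => simp [conv]
  | cons a w ih => simp [conv, ih, List.zip_map_left, Function.comp_def]

lemma append_of_mem_inits_zip_tails {w : List ℕ} {p : List ℕ × List ℕ}
    (h : p ∈ w.inits.zip w.tails) : p.1 ++ p.2 = w := by
  induction w generalizing p with
  | nil => simp at h; simp [h]
  | cons a w ih =>
    rw [inits_zip_tails_cons] at h
    simp only [List.mem_cons, List.mem_map] at h
    rcases h with rfl | ⟨q, hq, rfl⟩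
    · rfl
    · simp [ih hq]

lemma conv_eq_sum_range (w : List ℕ) :
    conv f g w = ∑ i ∈ Finset.range (w.length + 1), f (w.take i) * g (w.drop i) := by
  induction w generalizing f with
  | nil => simp [conv]
  | cons a w ih =>
    rw [Finset.sum_range_succ', conv, ih]
    simp [add_comm]

/-- Deconcatenation is compatible with shuffles. -/
lemma shSum_conv (u v : List ℕ) :
    shSum (conv f g) u v
      = ((u.inits.zip u.tails).map fun p => ((v.inits.zip v.tails).map fun q =>
          shSum f p.1 q.1 * shSum g p.2 q.2).sum).sum := by
  induction u, v using sh_induction generalizing f with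
  | hl v => simp [conv_eq_sum_zip]
  | hr u => simp [conv_eq_sum_zip]
  | h a u b v h1 h2 =>
    rw [shSum_cons_cons]
    simp only [conv]
    rw [shSum_add, shSum_add, h1, h2]
    simp only [inits_zip_tails_cons, List.map_cons, List.map_map, Function.comp_def, List.sum_cons,
      shSum_nil_left, shSum_nil_right, shSum_cons_cons, add_mul, List.sum_map_add]
    have hm (h : List ℕ → ℚ) (u v : List ℕ) :
        shSum (fun w => f [] * h w) u v = f [] * shSum h u v :=
      shSum_map (AddMonoidHom.mulLeft (f [])) h u v
    rw [hm (fun w => g (a :: w)), hm (fun w => g (b :: w))]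
    ring

end conv

/-- Functions on words that vanish on nontrivial shuffles, like the coefficients of Lie elements. -/
def IsLieFun (f : List ℕ → ℚ) : Prop :=
  f [] = 0 ∧ ∀ u v : List ℕ, u ≠ [] → v ≠ [] → shSum f u v = 0

namespace IsLieFun

variable {f g : List ℕ → ℚ}

lemma shSum_cons (hf : IsLieFun f) (a : ℕ) (v u : List ℕ) (c : ℕ) (p : List ℕ) :
    shSum (fun w => f (c :: w)) p (u ++ a :: v)
      + (-1) ^ u.length * shSum (fun w => f (a :: w)) (u.reverse ++ c :: p) v = 0 := by
  induction u generalizing c p with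
  | nil =>
    have := hf.2 (c :: p) (a :: v) (by simp) (by simp)
    rw [shSum_cons_cons] at this
    simpa using this
  | cons b u ih =>
    have h1 := hf.2 (c :: p) (b :: (u ++ a :: v)) (by simp) (by simp)
    have h2 := ih b (c :: p)
    rw [shSum_cons_cons] at h1
    simp only [List.reverse_cons, List.append_assoc, List.cons_append, List.nil_append,
      List.length_cons, pow_succ]
    linarith

/-- Moving the letter `a` to the front of a word. -/
lemma apply_middle (hf : IsLieFun f) (u : List ℕ) (a : ℕ) (v : List ℕ) :
    f (u ++ a :: v) = (-1) ^ u.length * shSum (fun w => f (a :: w)) u.reverse v := by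
  cases u with
  | nil => simp
  | cons b u =>
    have := hf.shSum_cons a v u b []
    simp only [shSum_nil_left] at this
    simp only [List.cons_append, List.reverse_cons, List.length_cons, pow_succ]
    linarith

lemma reverse (hf : IsLieFun f) : IsLieFun fun w => f w.reverse :=
  ⟨by simpa using hf.1, fun u v hu hv => by
    rw [shSum_reverse]; exact hf.2 _ _ (by simpa using hu) (by simpa using hv)⟩

/-- Moving the letter `a` to the end of a word. -/
lemma apply_middle' (hf : IsLieFun f) (u : List ℕ) (a : ℕ) (v : List ℕ) :
    f (u ++ a :: v) = (-1) ^ v.length * shSum (fun w => f (w ++ [a])) u v.reverse := by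
  have := hf.reverse.apply_middle v.reverse a u.reverse
  simp only [List.reverse_append, List.reverse_cons, List.reverse_reverse, List.append_assoc,
    List.length_reverse, List.cons_append, List.nil_append] at this
  rw [this, shSum_reverse (fun w => f (w ++ [a])), List.reverse_reverse, shSum_comm]

lemma bracket (hf : IsLieFun f) (hg : IsLieFun g) :
    IsLieFun fun w => conv f g w - conv g f w := by
  have key {f g : List ℕ → ℚ} (hf : IsLieFun f) (hg : IsLieFun g) (a : ℕ) (u : List ℕ) (b : ℕ)
      (v : List ℕ) : shSum (conv f g) (a :: u) (b :: v)
        = f (a :: u) * g (b :: v) + f (b :: v) * g (a :: u) := by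
    have e (h : List ℕ → List ℕ → ℚ) (b : ℕ) (v : List ℕ) (h0 : ∀ c p q, q ≠ [] → h (c :: p) q = 0) :
        ((((b :: v).inits.zip (b :: v).tails)).map fun q => h q.1 q.2).sum
          = h [] (b :: v) + h (b :: v) [] := by
      have (w : List ℕ) : ∀ (h : List ℕ → List ℕ → ℚ), (∀ p q, q ≠ [] → h p q = 0) →
          ((w.inits.zip w.tails).map fun q => h q.1 q.2).sum = h w [] := by
        induction w with
        | nil => intro h _; simp
        | cons d w ih =>
          intro h h0
          have := ih (fun p q => h (d :: p) q) (fun p q hq => h0 _ _ hq)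
          simp [List.zip_map_left, Function.comp_def, this, h0 [] (d :: w)]
      have := this v (fun p q => h (b :: p) q) (fun p q hq => h0 _ _ _ hq)
      simp [List.zip_map_left, Function.comp_def, this]
    rw [shSum_conv, e (fun p p' => (((b :: v).inits.zip (b :: v).tails).map fun q =>
      shSum f p q.1 * shSum g p' q.2).sum), e (fun p q => shSum f [] p * shSum g (a :: u) q),
      e (fun p q => shSum f (a :: u) p * shSum g [] q)]
    · simp [hf.1, hg.1]; ring
    · intro c p q hq
      rw [hf.2 _ _ (by simp) (by simp), zero_mul]
    · intro c p q hq
      rw [hg.2 _ _ (by simp) hq, mul_zero]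
    · intro c p q hq
      rw [e (fun p' q' => shSum f (c :: p) p' * shSum g q q')]
      · simp [hf.2 (c :: p) (b :: v), hg.2 q (b :: v), hq]
      · intro d p' q' hq'
        rw [hf.2 _ _ (by simp) (by simp), zero_mul]
  refine ⟨by simp [conv, hf.1], ?_⟩
  intro u v hu hv
  obtain ⟨a, u, rfl⟩ := List.exists_cons_of_ne_nil hu
  obtain ⟨b, v, rfl⟩ := List.exists_cons_of_ne_nil hv
  rw [shSum_sub, key hf hg, key hg hf]
  ring

lemma zero : IsLieFun fun _ => 0 := ⟨rfl, fun _ _ _ _ => shSum_eq_zero fun _ _ => rfl⟩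

lemma add (hf : IsLieFun f) (hg : IsLieFun g) : IsLieFun fun w => f w + g w :=
  ⟨by simp [hf.1, hg.1], fun u v hu hv => by
    rw [shSum_add, hf.2 u v hu hv, hg.2 u v hu hv, add_zero]⟩

lemma smul (hf : IsLieFun f) (c : ℚ) : IsLieFun fun w => c * f w :=
  ⟨by simp [hf.1], fun u v hu hv => by
    have := shSum_map (AddMonoidHom.mulLeft c) f u v
    simp only [AddMonoidHom.coe_mulLeft] at this
    rw [this, hf.2 u v hu hv, mul_zero]⟩

end IsLieFun

/-! ### Fundamental quasi-symmetric functions -/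

/-- Functions on finite alphabets of signed variables. -/
abbrev QFun : Type := List (Bool × ℚ) → ℚ

/-- The usual strict order for the sign `true`, and its opposite for `false`. -/
def ltSign (s : Bool) (a b : ℕ) : Prop := if s then a < b else b < a

instance (s : Bool) : DecidableRel (ltSign s) := fun a b => by
  unfold ltSign; infer_instance

lemma ltSign_trans {s : Bool} {a b c : ℕ} (h : ltSign s a b) (h' : ltSign s b c) :
    ltSign s a c := by
  cases s <;> (simp_all [ltSign]; omega)

lemma ltSign_not (s : Bool) (a b : ℕ) : ltSign (!s) a b ↔ ltSign s b a := by
  cases s <;> simp [ltSign]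

lemma ltSign_not_eq (s : Bool) : ltSign (!s) = fun a b => ltSign s b a := by
  funext a b; exact propext (ltSign_not s a b)

lemma ltSign_true : ltSign true = (· < ·) := by
  funext a b; simp [ltSign]

lemma ltSign_asymm {s : Bool} {a b : ℕ} (h : ltSign s a b) : ¬ ltSign s b a := by
  cases s <;> simp_all only [ltSign, if_true, Bool.false_eq_true, if_false] <;> omega

lemma ltSign_total {s : Bool} {a b : ℕ} (h : a ≠ b) : ltSign s a b ∨ ltSign s b a := by
  cases s <;> simp_all [ltSign] <;> omega

/-- The contribution of one signed variable: the word has to be monotone. -/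
def block (p : Bool × ℚ) (w : List ℕ) : ℚ :=
  if w.Pairwise (ltSign p.1) then p.2 ^ w.length else 0

lemma block_cons (p : Bool × ℚ) (a : ℕ) (w : List ℕ) :
    block p (a :: w) = if ∀ b ∈ w, ltSign p.1 a b then p.2 * block p w else 0 := by
  simp only [block, List.pairwise_cons, List.length_cons, pow_succ]
  split_ifs <;> simp_all [mul_comm]

@[simp] lemma block_nil (p : Bool × ℚ) : block p [] = 1 := by simp [block]

lemma block_reverse (p : Bool × ℚ) (w : List ℕ) : block p w.reverse = block (!p.1, p.2) w := by
  simp only [block, List.pairwise_reverse, ltSign_not_eq, List.length_reverse]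

lemma shSum_mul_left (c : ℚ) (f : List ℕ → ℚ) (u v : List ℕ) :
    shSum (fun w => c * f w) u v = c * shSum f u v :=
  shSum_map (AddMonoidHom.mulLeft c) f u v

lemma shSum_block_cons (p : Bool × ℚ) (a : ℕ) (u v : List ℕ) :
    shSum (fun w => block p (a :: w)) u v
      = if ∀ b ∈ u ++ v, ltSign p.1 a b then p.2 * shSum (block p) u v else 0 := by
  split_ifs with h
  · rw [← shSum_mul_left]
    refine shSum_congr fun w hw => ?_
    rw [block_cons, if_pos]
    exact fun b hb => h b (hw.subset hb)
  · refine shSum_eq_zero fun w hw => ?_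
    rw [block_cons, if_neg]
    exact fun h' => h fun b hb => h' b (hw.symm.subset hb)

lemma shSum_block (p : Bool × ℚ) (u v : List ℕ) (h : (u ++ v).Nodup) :
    shSum (block p) u v = block p u * block p v := by
  induction u, v using sh_induction with
  | hl v => simp
  | hr u => simp
  | h a u b v h1 h2 =>
    have n1 : (u ++ b :: v).Nodup := (List.nodup_cons.1 h).2
    have n2 : (a :: u ++ v).Nodup := (List.nodup_middle.1 h).of_cons
    have hab : a ≠ b := by rintro rfl; simp at h
    rw [shSum_cons_cons, shSum_block_cons, shSum_block_cons, h1 n1, h2 n2]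
    simp only [block_cons p b v, block_cons p a u, List.cons_append, List.forall_mem_cons,
      List.forall_mem_append]
    by_cases hu : ∀ c ∈ u, ltSign p.1 a c
    · by_cases hv : ∀ c ∈ v, ltSign p.1 b c
      · rcases ltSign_total (s := p.1) hab with hl | hl
        · have := ltSign_asymm hl
          have hv' : ∀ c ∈ v, ltSign p.1 a c := fun c hc => ltSign_trans hl (hv c hc)
          rw [if_pos ⟨hu, hl, hv'⟩, if_neg (c := ltSign p.1 b a ∧ _) (fun h => this h.1), if_pos hu,
            if_pos hv]
          ring
        · have := ltSign_asymm hl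
          have hu' : ∀ c ∈ u, ltSign p.1 b c := fun c hc => ltSign_trans hl (hu c hc)
          rw [if_neg (fun h => this h.2.1), if_pos ⟨hl, hu', hv⟩, if_pos hu, if_pos hv]; ring
      · simp [hv]
    · simp [hu]

/-- The fundamental quasi-symmetric function of a word, evaluated at an alphabet. -/
def quasi : List (Bool × ℚ) → List ℕ → ℚ
  | [], w => if w = [] then 1 else 0
  | p :: c, w => conv (block p) (quasi c) w

lemma quasi_cons (p : Bool × ℚ) (c : List (Bool × ℚ)) :
    quasi (p :: c) = conv (block p) (quasi c) := rfl

lemma quasi_nil (c : List (Bool × ℚ)) : quasi c [] = 1 := by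
  induction c with
  | nil => simp [quasi]
  | cons p c ih => simp [quasi, conv, ih]

lemma shSum_quasi (c : List (Bool × ℚ)) (u v : List ℕ) (h : (u ++ v).Nodup) :
    shSum (quasi c) u v = quasi c u * quasi c v := by
  induction c generalizing u v with
  | nil =>
    cases u with
    | nil => simp [quasi]
    | cons a u =>
      rw [shSum_eq_zero]
      · simp [quasi]
      · intro w hw
        simp only [quasi, ite_eq_right_iff]
        rintro rfl
        simpa using hw.length_eq
  | cons p c ih =>
    have : shSum (conv (block p) (quasi c)) u v = _ := shSum_conv _ _ u v
    simp only [quasi] at this ⊢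
    rw [this, conv_eq_sum_zip, conv_eq_sum_zip, ← List.sum_map_mul_right]
    congr 1
    refine List.map_congr_left fun x hx => ?_
    rw [← List.sum_map_mul_left]
    congr 1
    refine List.map_congr_left fun y hy => ?_
    have ex := append_of_mem_inits_zip_tails hx
    have ey := append_of_mem_inits_zip_tails hy
    have hn : ((x.1 ++ y.1) ++ (x.2 ++ y.2)).Nodup := by
      refine (List.Perm.nodup_iff ?_).1 h
      rw [← ex, ← ey]
      simp only [List.append_assoc, List.perm_append_left_iff]
      simp only [← List.append_assoc]
      exact List.perm_append_comm.append_right _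
    rw [shSum_block _ _ _ hn.of_append_left, ih _ _ hn.of_append_right]
    ring

lemma quasi_append (c : List (Bool × ℚ)) (p : Bool × ℚ) (w : List ℕ) :
    quasi (c ++ [p]) w = conv (quasi c) (block p) w := by
  induction c generalizing w with
  | nil =>
    have h1 : conv (quasi []) (block p) ([] ++ w) = quasi [] [] * block p w := by
      apply conv_append
      intro u v _ hu
      have : u ≠ [] := by rintro rfl; simp at hu
      simp [quasi, this]
    have h2 : conv (block p) (quasi []) (w ++ []) = block p w * quasi [] [] := by
      apply conv_append
      intro u v e hu
      have : v ≠ [] := by rintro rfl; simp at e; simp [e] at hu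
      simp [quasi, this]
    simp only [List.append_nil, List.nil_append] at h1 h2 ⊢
    simp only [quasi] at h1 h2 ⊢
    rw [h1, h2, mul_comm]
  | cons q c ih =>
    rw [List.cons_append, quasi_cons, quasi_cons, conv_assoc,
      show quasi (c ++ [p]) = conv (quasi c) (block p) from funext ih]

lemma quasi_reverse (c : List (Bool × ℚ)) (w : List ℕ) :
    quasi c w.reverse = quasi (c.reverse.map fun p => (!p.1, p.2)) w := by
  induction c generalizing w with
  | nil => simp [quasi]
  | cons p c ih =>
    simp only [quasi, List.reverse_cons, List.map_append, List.map_cons, List.map_nil]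
    rw [quasi_append, conv_reverse]
    congr 1
    · exact funext ih
    · exact funext (block_reverse p)

/-- The fundamental quasi-symmetric function of a word. -/
def fund (w : List ℕ) : QFun := fun c => quasi c w

lemma fund_nil : fund [] = 1 := funext quasi_nil

lemma shSum_fund (u v : List ℕ) (h : (u ++ v).Nodup) : shSum fund u v = fund u * fund v := by
  funext c
  have := shSum_map (Pi.evalAddMonoidHom (fun _ : List (Bool × ℚ) => ℚ) c) fund u v
  simp only [Pi.evalAddMonoidHom_apply] at this
  rw [← this]
  exact shSum_quasi c u v h

/-- The operator reversing words. -/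
def revQ : QFun →ₗ[ℚ] QFun :=
  LinearMap.funLeft ℚ ℚ fun c => c.reverse.map fun p => (!p.1, p.2)

lemma revQ_fund (w : List ℕ) : revQ (fund w) = fund w.reverse :=
  funext fun c => (quasi_reverse c w).symm

/-- The values of the operator `consQ`. -/
def consQAux (s : Bool) (a : QFun) : QFun
  | [] => 0
  | p :: c => p.2 * (if p.1 = s then a (p :: c) else a c) + consQAux s a c

/-- The operator adding a first letter which is smaller (for the sign `true`) or larger (for the
sign `false`) than all others. -/
def consQ (s : Bool) : QFun →ₗ[ℚ] QFun where
  toFun := consQAux s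
  map_add' a b := by
    funext c
    induction c with
    | nil => simp [consQAux]
    | cons p c ih =>
      simp only [consQAux, Pi.add_apply] at ih ⊢
      rw [ih]; split_ifs <;> ring
  map_smul' r a := by
    funext c
    induction c with
    | nil => simp [consQAux]
    | cons p c ih =>
      simp only [consQAux, Pi.smul_apply, smul_eq_mul, RingHom.id_apply] at ih ⊢
      rw [ih]; split_ifs <;> ring

lemma consQ_fund (s : Bool) (b : ℕ) (w : List ℕ) (h : ∀ x ∈ w, ltSign s b x) :
    consQ s (fund w) = fund (b :: w) := by
  funext c
  change consQAux s (fund w) c = quasi c (b :: w)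
  induction c with
  | nil => simp [consQAux, quasi]
  | cons p c ih =>
    have e : quasi (p :: c) (b :: w)
        = quasi c (b :: w) + conv (fun u => block p (b :: u)) (quasi c) w := by
      simp [quasi, conv]
    rw [e, consQAux, ih, add_comm]
    congr 1
    split_ifs with hs
    · change p.2 * conv (block p) (quasi c) w = _
      rw [← conv_smul_left]
      refine conv_congr fun u v e => ?_
      rw [block_cons, if_pos]
      intro x hx
      rw [hs]
      exact h x (by simp [← e, hx])
    · have := conv_append (fun u => block p (b :: u)) (quasi c) (u := []) (v := w) ?_
      · simp only [List.nil_append] at this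
        rw [this]
        simp [block_cons, fund]
      · intro u v e hu
        cases u with
        | nil => simp at hu
        | cons x u =>
          rw [block_cons, if_neg, zero_mul]
          intro h'
          have h1 := h' x (by simp)
          have h2 := h x (by rw [show w = x :: u ++ v by simpa using e.symm]; simp)
          have h3 : p.1 = !s := by
            cases hp : p.1 <;> cases s <;> simp_all
          rw [h3, ltSign_not] at h1
          exact ltSign_asymm h1 h2

/-! ### Descent patterns -/

/-- The descent pattern of a word. -/
def desPat : List ℕ → List Bool
  | [] => []
  | [_] => []
  | a :: b :: w => decide (b < a) :: desPat (b :: w)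

lemma exists_interpolation (n k : ℕ) : ∃ α : ℕ → ℚ, ∀ i ≤ n,
    ∑ j ∈ Finset.range (n + 1), α j * (j : ℚ) ^ i = if i = k then 1 else 0 := by
  classical
  refine ⟨fun j => (Lagrange.basis (Finset.range (n + 1)) (fun j : ℕ => (j : ℚ)) j).coeff k, ?_⟩
  intro i hi
  have := Lagrange.eq_interpolate (s := Finset.range (n + 1)) (v := fun j : ℕ => (j : ℚ))
    (f := (Polynomial.X : Polynomial ℚ) ^ i) (fun a _ b _ h => by simpa using h)
    (by
      rw [Polynomial.degree_X_pow, Finset.card_range]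
      exact_mod_cast Nat.lt_succ_of_le hi)
  have := congrArg (fun p => p.coeff k) this
  simp only [Lagrange.interpolate_apply, Polynomial.eval_pow, Polynomial.eval_X,
    Polynomial.coeff_X_pow, Polynomial.finsetSum_coeff, Polynomial.coeff_C_mul] at this
  rw [show (if i = k then (1 : ℚ) else 0) = if k = i then 1 else 0 by simp [eq_comm], this]
  exact Finset.sum_congr rfl fun j _ => mul_comm _ _

/-- Extraction of an increasing prefix of given length. -/
lemma exists_extract_prefix (n k : ℕ) (hk : k ≤ n) : ∃ L : QFun →ₗ[ℚ] QFun,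
    ∀ w : List ℕ, w.length = n →
      L (fund w) = if (w.take k).Pairwise (· < ·) then fund (w.drop k) else 0 := by
  obtain ⟨α, hα⟩ := exists_interpolation n k
  refine ⟨∑ j ∈ Finset.range (n + 1),
    α j • LinearMap.funLeft ℚ ℚ (fun c => ((true, (j : ℚ)) : Bool × ℚ) :: c), ?_⟩
  intro w hw
  funext c
  have e (j : ℕ) : fund w ((true, (j : ℚ)) :: c) = ∑ i ∈ Finset.range (n + 1),
      (j : ℚ) ^ i * if (w.take i).Pairwise (· < ·) then quasi c (w.drop i) else 0 := by
    change conv _ _ w = _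
    rw [conv_eq_sum_range, hw]
    refine Finset.sum_congr rfl fun i hi => ?_
    have : min i w.length = i := by rw [hw]; simp at hi; omega
    simp [block, ltSign_true, this]
  simp only [LinearMap.sum_apply, LinearMap.smul_apply, Finset.sum_apply, Pi.smul_apply,
    LinearMap.funLeft_apply, smul_eq_mul, e, Finset.mul_sum]
  rw [Finset.sum_comm]
  have : ∀ i ∈ Finset.range (n + 1), ∑ j ∈ Finset.range (n + 1), α j * ((j : ℚ) ^ i *
      if (w.take i).Pairwise (· < ·) then quasi c (w.drop i) else 0)
      = if i = k then (if (w.take i).Pairwise (· < ·) then quasi c (w.drop i) else 0) else 0 := by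
    intro i hi
    simp only [← mul_assoc, ← Finset.sum_mul]
    rw [hα i (by simp at hi; omega)]
    split_ifs <;> simp
  rw [Finset.sum_congr rfl this, Finset.sum_ite_eq' (Finset.range (n + 1)) k, if_pos (by simp; omega)]
  split_ifs <;> rfl

lemma desPat_eq_replicate (w : List ℕ) (k : ℕ) (hw : w.Nodup) (h : w.length = k + 1) :
    desPat w = List.replicate k false ↔ w.Pairwise (· < ·) := by
  rw [← List.isChain_iff_pairwise]
  induction k generalizing w with
  | zero =>
    match w, h with
    | [a], _ => simp [desPat]
  | succ k ih =>
    match w, h with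
    | a :: b :: w, h =>
      have := ih (b :: w) hw.of_cons (by simpa using h)
      have hab : a ≠ b := by rintro rfl; simp at hw
      rw [desPat, List.replicate_succ, List.cons.injEq, this, List.isChain_cons_cons]
      simp only [decide_eq_false_iff_not, not_lt]
      constructor <;> rintro ⟨h1, h2⟩ <;> exact ⟨by omega, h2⟩

lemma desPat_prefix (w : List ℕ) (k : ℕ) (p : List Bool) (hw : w.Nodup)
    (h : w.length = k + p.length + 2) :
    ((w.take (k + 1)).Pairwise (· < ·) ∧ desPat (w.drop (k + 1)) = p) ↔
      (desPat w = List.replicate k false ++ false :: p ∨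
        desPat w = List.replicate k false ++ true :: p) := by
  rw [← List.isChain_iff_pairwise]
  induction k generalizing w with
  | zero =>
    match w, h with
    | a :: b :: w, h =>
      simp only [desPat]
      by_cases hab : b < a <;> simp [hab]
  | succ k ih =>
    match w, h with
    | a :: b :: w, h =>
      have := ih (b :: w) hw.of_cons (by simp at h ⊢; omega)
      have hab : a ≠ b := by rintro rfl; simp at hw
      simp only [List.take_succ_cons, List.drop_succ_cons] at this ⊢
      rw [List.isChain_cons_cons, and_assoc, this]
      simp only [desPat, List.replicate_succ, List.cons_append, List.cons.injEq,
        decide_eq_false_iff_not, not_lt]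
      have : a < b ↔ a ≤ b := by omega
      rw [this]
      tauto

/-- Descent patterns are detected by linear functionals on fundamental functions. -/
lemma exists_functional (p : List Bool) (k : ℕ) : ∃ L : QFun →ₗ[ℚ] ℚ,
    ∀ w : List ℕ, w.Nodup → w.length = k + p.length + 1 →
      L (fund w) = if desPat w = List.replicate k false ++ p then 1 else 0 := by
  induction p generalizing k with
  | nil =>
    obtain ⟨L, hL⟩ := exists_extract_prefix (k + 1) (k + 1) le_rfl
    refine ⟨LinearMap.proj [] ∘ₗ L, fun w hw hl => ?_⟩
    simp only [List.length_nil, add_zero] at hl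
    have : w.take (k + 1) = w := List.take_of_length_le hl.le
    have h' : w.drop (k + 1) = [] := List.drop_of_length_le hl.le
    simp only [LinearMap.comp_apply, hL w hl, this, h', fund_nil, List.append_nil,
      desPat_eq_replicate w k hw hl]
    split_ifs <;> simp
  | cons b p ih =>
    obtain ⟨L₁, h₁⟩ := ih (k + 1)
    have e : List.replicate (k + 1) false ++ p = List.replicate k false ++ false :: p := by
      rw [List.replicate_succ', List.append_assoc]; rfl
    cases b with
    | false =>
      refine ⟨L₁, fun w hw hl => ?_⟩
      rw [h₁ w hw (by simp at hl; omega), e]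
    | true =>
      obtain ⟨L₂, h₂⟩ := ih 0
      obtain ⟨E, hE⟩ := exists_extract_prefix (k + p.length + 2) (k + 1) (by omega)
      refine ⟨L₂ ∘ₗ E - L₁, fun w hw hl => ?_⟩
      have hl' : w.length = k + p.length + 2 := by simp at hl; omega
      rw [LinearMap.sub_apply, LinearMap.comp_apply, hE w hl', h₁ w hw (by omega), e]
      have hd : (w.drop (k + 1)).Nodup := hw.sublist (List.drop_sublist _ _)
      have h3 := h₂ (w.drop (k + 1)) hd (by simp [hl']; omega)
      have h4 := desPat_prefix w k p hw hl'
      have h5 : List.replicate k false ++ false :: p ≠ List.replicate k false ++ true :: p := by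
        simp
      simp only [List.replicate_zero, List.nil_append] at h3
      by_cases c1 : desPat w = List.replicate k false ++ false :: p
      · have := h4.2 (Or.inl c1)
        rw [if_pos this.1, h3, if_pos this.2, if_pos c1, if_neg (by rw [c1]; exact h5), sub_self]
      · by_cases c2 : desPat w = List.replicate k false ++ true :: p
        · have := h4.2 (Or.inr c2)
          rw [if_pos this.1, h3, if_pos this.2, if_neg c1, if_pos c2, sub_zero]
        · rw [if_neg c1, if_neg c2, sub_zero]
          split_ifs with c3
          · rw [h3, if_neg]
            intro c4
            exact (h4.1 ⟨c3, c4⟩).elim c1 c2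
          · simp

/-! ### Coefficients of brackets and of the elements `c_t` -/

lemma catW_apply (x y : FW ℚ) (w : List ℕ) : catW x y w = conv x y w := by
  have hx0 (y : FW ℚ) : catW 0 y = 0 := by simp [catW]
  have hy0 (x : FW ℚ) : catW x 0 = 0 := by simp [catW]
  have hxa (x x' y : FW ℚ) : catW (x + x') y = catW x y + catW x' y := by
    unfold catW
    rw [Finsupp.sum_add_index'] <;> intros <;> simp [add_mul, Finsupp.sum_add]
  have hya (x y y' : FW ℚ) : catW x (y + y') = catW x y + catW x y' := by
    unfold catW
    rw [← Finsupp.sum_add]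
    refine Finsupp.sum_congr fun u _ => ?_
    rw [Finsupp.sum_add_index'] <;> intros <;> simp [mul_add]
  induction x using Finsupp.induction_linear with
  | zero => rw [hx0, conv_eq_zero] <;> simp
  | add x x' h h' =>
    rw [hxa, Finsupp.add_apply, h, h', ← conv_add_left]; rfl
  | single u a =>
    induction y using Finsupp.induction_linear with
    | zero => rw [hy0, conv_eq_zero] <;> simp
    | add y y' h h' =>
      rw [hya, Finsupp.add_apply, h, h', ← conv_add_right]; rfl
    | single v b =>
      have e : catW (Finsupp.single u a) (Finsupp.single v b) = Finsupp.single (u ++ v) (a * b) := by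
        simp [catW]
      rw [e]
      by_cases h : u ++ v = w
      · subst h
        rw [conv_append]
        · simp
        · intro u' v' _ hu
          have : u ≠ u' := by rintro rfl; exact hu rfl
          simp [Finsupp.single_apply, this]
      · rw [conv_eq_zero]
        · simp [h]
        · intro u' v' e
          by_cases h1 : u = u'
          · have : v ≠ v' := by rintro rfl; exact h (by rw [h1, e])
            simp [Finsupp.single_apply, this]
          · simp [Finsupp.single_apply, h1]

lemma brakW_apply (x y : FW ℚ) (w : List ℕ) : brakW x y w = conv x y w - conv y x w := by
  rw [brakW, Finsupp.sub_apply, catW_apply, catW_apply]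

lemma exists_of_conv_ne_zero {f g : List ℕ → ℚ} {w : List ℕ} (h : conv f g w ≠ 0) :
    ∃ u v, u ++ v = w ∧ f u ≠ 0 ∧ g v ≠ 0 := by
  by_contra! H
  refine h (conv_eq_zero _ _ fun u v e => ?_)
  by_cases h1 : f u = 0
  · rw [h1, zero_mul]
  · rw [H u v e h1, mul_zero]

lemma perm_of_evalBT_ne_zero {t : BT} {w z : List ℕ} (hw : w.length = t.nodes + 1)
    (h : (evalBT t w : FW ℚ) z ≠ 0) : z.Perm w := by
  induction t generalizing w z with
  | nil =>
    simp only [evalBT, Finsupp.single_apply, ne_eq, ite_eq_right_iff, one_ne_zero, imp_false,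
      not_not] at h
    rw [h]
  | nd l r hl hr =>
    simp only [BT.nodes] at hw
    have h1 : (w.take (l.nodes + 1)).length = l.nodes + 1 := by simp; omega
    have h2 : (w.drop (l.nodes + 1)).length = r.nodes + 1 := by simp; omega
    rw [evalBT, brakW_apply] at h
    rw [← List.take_append_drop (l.nodes + 1) w]
    by_cases h3 : conv (evalBT l (w.take (l.nodes + 1)) : FW ℚ)
        (evalBT r (w.drop (l.nodes + 1)) : FW ℚ) z = 0
    · rw [h3, zero_sub, neg_ne_zero] at h
      obtain ⟨u, v, rfl, hu, hv⟩ := exists_of_conv_ne_zero h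
      exact List.perm_append_comm.trans ((hl h1 hv).append (hr h2 hu))
    · obtain ⟨u, v, rfl, hu, hv⟩ := exists_of_conv_ne_zero h3
      exact (hl h1 hu).append (hr h2 hv)

lemma isLieFun_evalBT {t : BT} {w : List ℕ} (hw : w.length = t.nodes + 1) :
    IsLieFun (evalBT t w : FW ℚ) := by
  induction t generalizing w with
  | nil =>
    simp only [BT.nodes, zero_add, List.length_eq_one_iff] at hw
    obtain ⟨a, rfl⟩ := hw
    refine ⟨by simp [evalBT], fun u v hu hv => shSum_eq_zero fun z hz => ?_⟩
    rw [evalBT, Finsupp.single_apply, if_neg]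
    rintro rfl
    have := hz.length_eq
    have h1 := List.length_pos_of_ne_nil hu
    have h2 := List.length_pos_of_ne_nil hv
    simp at this
    omega
  | nd l r hl hr =>
    simp only [BT.nodes] at hw
    have h1 : (w.take (l.nodes + 1)).length = l.nodes + 1 := by simp; omega
    have h2 : (w.drop (l.nodes + 1)).length = r.nodes + 1 := by simp; omega
    have := (hl h1).bracket (hr h2)
    simp only [← brakW_apply] at this
    exact this

/-- The words obtained by permuting the letters of a given word. -/
def rearrangements (L : List ℕ) : Finset (List ℕ) := L.permutations.toFinset

lemma mem_rearrangements {L w : List ℕ} : w ∈ rearrangements L ↔ w.Perm L := by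
  simp [rearrangements]

/-- The analogue of `cElt` for labels taken from an arbitrary word. -/
noncomputable def cSum (t : BT) (L : List ℕ) : FW ℚ :=
  ∑ w ∈ (rearrangements L).filter (fun w => admB t w = true), evalBT t w

lemma cElt_eq_cSum (t : BT) : (cElt t : FW ℚ) = cSum t (List.range' 1 (t.nodes + 1)) := rfl

lemma cSum_congr (t : BT) {L L' : List ℕ} (h : L.Perm L') : cSum t L = cSum t L' := by
  have : rearrangements L = rearrangements L' := by
    ext w
    rw [mem_rearrangements, mem_rearrangements]
    exact ⟨fun h' => h'.trans h, fun h' => h'.trans h.symm⟩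
  rw [cSum, this, cSum]

lemma isLieFun_finset_sum {ι : Type*} (s : Finset ι) (f : ι → FW ℚ)
    (h : ∀ i ∈ s, IsLieFun (f i)) : IsLieFun (∑ i ∈ s, f i : FW ℚ) := by
  classical
  induction s using Finset.induction_on with
  | empty => exact IsLieFun.zero
  | insert i s hi ih =>
    rw [Finset.sum_insert hi]
    exact (h i (by simp)).add (ih fun j hj => h j (by simp [hj]))

lemma isLieFun_cSum {t : BT} {L : List ℕ} (hL : L.length = t.nodes + 1) :
    IsLieFun (cSum t L) := by
  refine isLieFun_finset_sum _ _ fun w hw => isLieFun_evalBT ?_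
  rw [Finset.mem_filter, mem_rearrangements] at hw
  rw [hw.1.length_eq, hL]

lemma bracket_apply {P Q : List ℕ → ℚ} {w₁ w₂ u v : List ℕ} {a b : ℕ}
    (hP : ∀ z, P z ≠ 0 → z.Perm w₁) (hQ : ∀ z, Q z ≠ 0 → z.Perm w₂)
    (hn : (w₁ ++ w₂).Nodup) (ha : a ∈ w₁) (hb : b ∈ w₂) :
    conv P Q (u ++ b :: a :: v) - conv Q P (u ++ b :: a :: v)
      = -(Q (u ++ [b]) * P (a :: v)) := by
  have hd := List.disjoint_of_nodup_append hn
  have h1 : conv P Q (u ++ b :: a :: v) = 0 := by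
    by_contra h
    obtain ⟨z₁, z₂, e, h₁, h₂⟩ := exists_of_conv_ne_zero h
    have p₁ := hP _ h₁
    have p₂ := hQ _ h₂
    rcases List.append_eq_append_iff.1 e with ⟨t, rfl, rfl⟩ | ⟨t, rfl, e'⟩
    · exact hd ha (p₂.subset (by simp))
    · match t, e' with
      | [], e' =>
        rw [List.nil_append] at e'
        exact hd ha (p₂.subset (by simp [← e']))
      | c :: t, e' =>
        obtain ⟨rfl, -⟩ := List.cons.inj e'
        exact hd (p₁.subset (by simp)) hb
  have h2 : conv Q P ((u ++ [b]) ++ (a :: v)) = Q (u ++ [b]) * P (a :: v) := by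
    apply conv_append
    intro z₁ z₂ e hl
    by_contra h
    have p₁ := hQ _ (left_ne_zero_of_mul h)
    have p₂ := hP _ (right_ne_zero_of_mul h)
    rcases List.append_eq_append_iff.1 e with ⟨t, e₁, rfl⟩ | ⟨t, rfl, e'⟩
    · rcases List.eq_nil_or_concat t with rfl | ⟨t', c, rfl⟩
      · rw [e₁] at hl; simp at hl
      · have : c = b := by
          have := congrArg List.getLast? e₁
          simpa using this.symm
        subst this
        exact hd (p₂.subset (by simp)) hb
    · match t, e' with
      | [], e' => simp at hl
      | c :: t, e' =>
        obtain ⟨rfl, -⟩ := List.cons.inj e'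
        exact hd ha (p₁.subset (by simp))
  rw [List.append_assoc] at h2
  simp only [List.cons_append, List.nil_append] at h2
  rw [h1, h2, zero_sub]

lemma evalBT_nd_apply {l r : BT} {L w u v : List ℕ} {a b : ℕ} (hL : L.Nodup)
    (hz : L.Perm (u ++ b :: a :: v)) (hab : ∀ x ∈ L, a ≤ x ∧ x ≤ b)
    (hn : L.length = (BT.nd l r).nodes + 1) (hw : w.Perm L) (hadm : admB (.nd l r) w = true) :
    (evalBT (.nd l r) w : FW ℚ) (u ++ b :: a :: v)
      = -((evalBT r (w.drop (l.nodes + 1)) : FW ℚ) (u ++ [b]) *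
          (evalBT l (w.take (l.nodes + 1)) : FW ℚ) (a :: v)) := by
  have hlen : w.length = l.nodes + r.nodes + 2 := by rw [hw.length_eq, hn, BT.nodes]
  have h1 : (w.take (l.nodes + 1)).length = l.nodes + 1 := by simp; omega
  have h2 : (w.drop (l.nodes + 1)).length = r.nodes + 1 := by simp; omega
  simp only [admB, Bool.and_eq_true, decide_eq_true_eq] at hadm
  have hmin : w.minimum = WithTop.some a :=
    List.minimum_eq_coe_iff.2 ⟨hw.symm.subset (hz.symm.subset (by simp)),
      fun x hx => (hab x (hw.subset hx)).1⟩
  have hmax : w.maximum = WithBot.some b :=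
    List.maximum_eq_coe_iff.2 ⟨hw.symm.subset (hz.symm.subset (by simp)),
      fun x hx => (hab x (hw.subset hx)).2⟩
  have ha : a ∈ w.take (l.nodes + 1) := (List.minimum_eq_coe_iff.1 (hadm.1.2.trans hmin)).1
  have hb : b ∈ w.drop (l.nodes + 1) := (List.maximum_eq_coe_iff.1 (hadm.2.trans hmax)).1
  rw [evalBT, brakW_apply]
  refine bracket_apply (fun z => perm_of_evalBT_ne_zero h1) (fun z => perm_of_evalBT_ne_zero h2)
    ?_ ha hb
  rw [List.take_append_drop]
  exact hw.symm.nodup hL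

lemma cSum_nd_apply {l r : BT} {L u v : List ℕ} {a b : ℕ} (hL : L.Nodup)
    (hz : L.Perm (u ++ b :: a :: v)) (hab : ∀ x ∈ L, a ≤ x ∧ x ≤ b)
    (hn : L.length = (BT.nd l r).nodes + 1) (hv : v.length = l.nodes) :
    cSum (.nd l r) L (u ++ b :: a :: v)
      = -(cSum r (u ++ [b]) (u ++ [b]) * cSum l (a :: v) (a :: v)) := by
  have hn' : L.length = l.nodes + r.nodes + 2 := by rw [hn, BT.nodes]
  have hz' : ((a :: v) ++ (u ++ [b])).Perm L := by
    refine List.Perm.trans ?_ hz.symm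
    refine List.perm_append_comm.trans ?_
    simp
  unfold cSum
  rw [Finsupp.finsetSum_apply, Finsupp.finsetSum_apply, Finsupp.finsetSum_apply, mul_comm,
    Finset.sum_mul_sum, ← Finset.sum_product', ← Finset.sum_neg_distrib]
  symm
  refine Finset.sum_of_injOn (fun p : List ℕ × List ℕ => p.1 ++ p.2) ?_ ?_ ?_ ?_
  · rintro ⟨x, y⟩ hx ⟨x', y'⟩ hx' e
    simp only [Finset.coe_product, Finset.coe_filter, Set.mem_prod, Set.mem_ofPred_eq,
      mem_rearrangements] at hx hx'
    have := List.append_inj e (hx.1.1.length_eq.trans hx'.1.1.length_eq.symm)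
    exact Prod.ext this.1 this.2
  · rintro ⟨x, y⟩ hx
    simp only [Finset.coe_product, Finset.coe_filter, Set.mem_prod, Set.mem_ofPred_eq,
      mem_rearrangements] at hx ⊢
    obtain ⟨⟨hx, hxa⟩, hy, hya⟩ := hx
    have hxy : (x ++ y).Perm L := (hx.append hy).trans hz'
    have hlx : x.length = l.nodes + 1 := by rw [hx.length_eq]; simp [hv]
    have e1 : (x ++ y).take (l.nodes + 1) = x := by rw [← hlx, List.take_left']; rfl
    have e2 : (x ++ y).drop (l.nodes + 1) = y := by rw [← hlx, List.drop_left']; rfl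
    have hax : a ∈ x := hx.symm.subset (by simp)
    have hby : b ∈ y := hy.symm.subset (by simp)
    have mem_x {c} (hc : c ∈ x) : c ∈ x ++ y := List.mem_append_left _ hc
    have mem_y {c} (hc : c ∈ y) : c ∈ x ++ y := List.mem_append_right _ hc
    refine ⟨hxy, ?_⟩
    simp only [admB, e1, e2, hxa, hya, Bool.and_eq_true, decide_eq_true_eq, true_and]
    constructor
    · rw [List.minimum_eq_coe_iff.2 ⟨hax, fun c hc => (hab c (hxy.subset (mem_x hc))).1⟩,
        List.minimum_eq_coe_iff.2 ⟨mem_x hax, fun c hc => (hab c (hxy.subset hc)).1⟩]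
    · rw [List.maximum_eq_coe_iff.2 ⟨hby, fun c hc => (hab c (hxy.subset (mem_y hc))).2⟩,
        List.maximum_eq_coe_iff.2 ⟨mem_y hby, fun c hc => (hab c (hxy.subset hc)).2⟩]
  · intro w hw hi
    rw [Finset.mem_filter, mem_rearrangements] at hw
    obtain ⟨hw, hadm⟩ := hw
    rw [evalBT_nd_apply hL hz hab hn hw hadm]
    by_contra h
    rw [neg_eq_zero] at h
    have hlen : w.length = l.nodes + r.nodes + 2 := by rw [hw.length_eq, hn']
    have h1 : (w.take (l.nodes + 1)).length = l.nodes + 1 := by simp; omega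
    have h2 : (w.drop (l.nodes + 1)).length = r.nodes + 1 := by simp; omega
    have p2 := perm_of_evalBT_ne_zero h2 (left_ne_zero_of_mul h)
    have p1 := perm_of_evalBT_ne_zero h1 (right_ne_zero_of_mul h)
    simp only [admB, Bool.and_eq_true, decide_eq_true_eq] at hadm
    refine hi ⟨(w.take (l.nodes + 1), w.drop (l.nodes + 1)), ?_, List.take_append_drop _ _⟩
    simp only [Finset.coe_product, Finset.coe_filter, Set.mem_prod, Set.mem_ofPred_eq,
      mem_rearrangements]
    exact ⟨⟨p1.symm, hadm.1.1.1⟩, p2.symm, hadm.1.1.2⟩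
  · rintro ⟨x, y⟩ hx
    simp only [Finset.mem_product, Finset.mem_filter, mem_rearrangements] at hx
    obtain ⟨⟨hx, hxa⟩, hy, hya⟩ := hx
    have hxy : (x ++ y).Perm L := (hx.append hy).trans hz'
    have hlx : x.length = l.nodes + 1 := by rw [hx.length_eq]; simp [hv]
    have e1 : (x ++ y).take (l.nodes + 1) = x := by rw [← hlx, List.take_left']; rfl
    have e2 : (x ++ y).drop (l.nodes + 1) = y := by rw [← hlx, List.drop_left']; rfl
    have hax : a ∈ x := hx.symm.subset (by simp)
    have hby : b ∈ y := hy.symm.subset (by simp)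
    have hd := List.disjoint_of_nodup_append (hxy.symm.nodup hL)
    have hly : y.length = r.nodes + 1 := by
      have := hxy.length_eq
      simp at this; omega
    rw [evalBT, brakW_apply, e1, e2, bracket_apply (w₁ := x) (w₂ := y)
      (fun z => perm_of_evalBT_ne_zero hlx) (fun z => perm_of_evalBT_ne_zero hly)
      (hxy.symm.nodup hL) hax hby, mul_comm]

lemma cSum_nd_apply_eq_zero {l r : BT} {L u v : List ℕ} {a b : ℕ} (hL : L.Nodup)
    (hz : L.Perm (u ++ b :: a :: v)) (hab : ∀ x ∈ L, a ≤ x ∧ x ≤ b)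
    (hn : L.length = (BT.nd l r).nodes + 1) (hv : v.length ≠ l.nodes) :
    cSum (.nd l r) L (u ++ b :: a :: v) = 0 := by
  unfold cSum
  rw [Finsupp.finsetSum_apply]
  refine Finset.sum_eq_zero fun w hw => ?_
  rw [Finset.mem_filter, mem_rearrangements] at hw
  obtain ⟨hw, hadm⟩ := hw
  rw [evalBT_nd_apply hL hz hab hn hw hadm, neg_eq_zero]
  by_contra h
  have hlen : w.length = l.nodes + r.nodes + 2 := by rw [hw.length_eq, hn, BT.nodes]
  have h1 : (w.take (l.nodes + 1)).length = l.nodes + 1 := by simp; omega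
  have p1 := perm_of_evalBT_ne_zero h1 (right_ne_zero_of_mul h)
  have := p1.length_eq
  rw [h1] at this
  simp at this
  exact hv this

/-! ### The coefficients of a Lie element in terms of the elements `c_t` -/

lemma mem_allBT {m : ℕ} {t : BT} : t ∈ allBT m ↔ t.nodes = m := by
  induction t generalizing m with
  | nil =>
    cases m with
    | zero => simp [allBT, BT.nodes]
    | succ m => simp [allBT, BT.nodes]
  | nd l r hl hr =>
    cases m with
    | zero => simp [allBT, BT.nodes]
    | succ m =>
      rw [allBT]
      simp only [Finset.mem_biUnion, Finset.mem_attach, true_and, Finset.mem_image,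
        Finset.mem_product, BT.nd.injEq, Prod.exists, Subtype.exists, Finset.mem_range, BT.nodes]
      constructor
      · rintro ⟨k, hk, l', r', ⟨h1, h2⟩, rfl, rfl⟩
        rw [hl.1 h1, hr.1 h2]
        omega
      · intro h
        exact ⟨l.nodes, by omega, l, r, ⟨hl.2 rfl, hr.2 (by omega)⟩, rfl, rfl⟩

lemma sum_allBT_succ {M : Type*} [AddCommMonoid M] {k j : ℕ} (g : BT → M)
    (hg : ∀ l r : BT, l.nodes + r.nodes = k + j → l.nodes ≠ k → g (.nd l r) = 0) :
    ∑ t ∈ allBT (k + j + 1), g t = ∑ l ∈ allBT k, ∑ r ∈ allBT j, g (.nd l r) := by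
  rw [← Finset.sum_product']
  symm
  refine Finset.sum_of_injOn (fun p : BT × BT => BT.nd p.1 p.2) ?_ ?_ ?_ ?_
  · rintro ⟨l, r⟩ _ ⟨l', r'⟩ _ e
    obtain ⟨rfl, rfl⟩ := BT.nd.inj e
    rfl
  · rintro ⟨l, r⟩ h
    simp only [Finset.coe_product, Set.mem_prod, Finset.mem_coe, mem_allBT] at h
    simp only [Finset.mem_coe, mem_allBT, BT.nodes]
    omega
  · intro t ht hi
    rw [mem_allBT] at ht
    cases t with
    | nil => simp [BT.nodes] at ht
    | nd l r =>
      simp only [BT.nodes] at ht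
      refine hg l r (by omega) fun hl => hi ⟨(l, r), ?_, rfl⟩
      simp only [Finset.coe_product, Set.mem_prod, Finset.mem_coe, mem_allBT]
      omega
  · intros; rfl

mutual
/-- The expansion coefficient of `c_t` in the words starting with their smallest letter. -/
noncomputable def coeffL : BT → QFun
  | .nil => 1
  | .nd l r => (-1 : ℚ) ^ r.nodes • (consQ false (revQ (coeffR r)) * coeffL l)

/-- The expansion coefficient of `c_t` in the words ending with their largest letter. -/
noncomputable def coeffR : BT → QFun
  | .nil => 1
  | .nd l r => (-1 : ℚ) ^ l.nodes • (coeffR r * revQ (consQ true (coeffL l)))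
end

lemma shSum_smul_const (f : List ℕ → ℚ) (x : QFun) (u v : List ℕ) :
    shSum (fun w => f w • x) u v = shSum f u v • x :=
  shSum_map (LinearMap.toSpanSingleton ℚ QFun x).toAddMonoidHom f u v

lemma neg_one_pow_mul_self (k : ℕ) : (-1 : ℚ) ^ k * (-1) ^ k = 1 := by
  rw [← mul_pow]; norm_num

lemma sum_cSum_nil {a : ℕ} (f : BT → QFun) :
    ∑ t ∈ allBT 0, cSum t [a] [a] • f t = f .nil := by
  have : rearrangements [a] = {[a]} := by
    ext w; simp [mem_rearrangements]
  simp [allBT, cSum, this, admB, evalBT]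

lemma exists_max_mem {v : List ℕ} (hv : v ≠ []) : ∃ b ∈ v, ∀ x ∈ v, x ≤ b := by
  obtain ⟨b, hb, h⟩ := v.toFinset.exists_max_image id (by simpa using hv)
  exact ⟨b, by simpa using hb, by simpa using h⟩

lemma exists_min_mem {v : List ℕ} (hv : v ≠ []) : ∃ b ∈ v, ∀ x ∈ v, b ≤ x := by
  obtain ⟨b, hb, h⟩ := v.toFinset.exists_min_image id (by simpa using hv)
  exact ⟨b, by simpa using hb, by simpa using h⟩

/-- The identity expressing `fund v` by the coefficients of `c_t` at words starting with their
smallest letter. -/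
def ExpandL (m : ℕ) : Prop :=
  ∀ (a : ℕ) (v : List ℕ), v.length = m → v.Nodup → (∀ x ∈ v, a < x) →
    ∑ t ∈ allBT m, cSum t (a :: v) (a :: v) • coeffL t = fund v

/-- The identity expressing `fund u` by the coefficients of `c_t` at words ending with their
largest letter. -/
def ExpandR (m : ℕ) : Prop :=
  ∀ (b : ℕ) (u : List ℕ), u.length = m → u.Nodup → (∀ x ∈ u, x < b) →
    ∑ t ∈ allBT m, cSum t (u ++ [b]) (u ++ [b]) • coeffR t = fund u

/-- The common part of the inductive steps for `ExpandL` and `ExpandR`. -/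
lemma sum_cSum_smul {A u v : List ℕ} {a b : ℕ} (hA : A.Nodup) (hz : A.Perm (u ++ b :: a :: v))
    (hab : ∀ x ∈ A, a ≤ x ∧ x ≤ b) (hL : ExpandL v.length) (hR : ExpandR u.length)
    {c : BT → QFun} {E F : QFun →ₗ[ℚ] QFun}
    (hc : ∀ l r, l.nodes = v.length → r.nodes = u.length →
      c (.nd l r) = E (coeffR r) * F (coeffL l)) :
    ∑ t ∈ allBT (v.length + u.length + 1), cSum t A (u ++ b :: a :: v) • c t
      = -(E (fund u) * F (fund v)) := by
  have hlen : A.length = v.length + u.length + 2 := by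
    rw [hz.length_eq]; simp; omega
  have hN := hz.nodup hA
  have ha : ∀ x ∈ v, a < x := fun x hx => by
    have h1 := (hab x (hz.symm.subset (by simp [hx]))).1
    have h2 : x ≠ a := by
      rintro rfl
      simp [List.nodup_append, hx] at hN
    omega
  have hb : ∀ x ∈ u, x < b := fun x hx => by
    have h1 := (hab x (hz.symm.subset (by simp [hx]))).2
    have h2 : x ≠ b := by
      rintro rfl
      exact (List.nodup_append.1 hN).2.2 x hx x (by simp) rfl
    omega
  have hv : v.Nodup := (List.nodup_cons.1 (List.nodup_cons.1 (List.nodup_append.1 hN).2.1).2).2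
  have hu : u.Nodup := (List.nodup_append.1 hN).1
  rw [sum_allBT_succ, ← hL a v rfl hv ha, ← hR b u rfl hu hb, map_sum, map_sum,
    Finset.sum_mul_sum, Finset.sum_comm, ← Finset.sum_neg_distrib]
  · refine Finset.sum_congr rfl fun r hr => ?_
    rw [← Finset.sum_neg_distrib]
    refine Finset.sum_congr rfl fun l hl => ?_
    rw [mem_allBT] at hl hr
    rw [cSum_nd_apply hA hz hab (by rw [BT.nodes]; omega) hl.symm, hc l r hl hr, map_smul,
      map_smul, smul_mul_smul_comm, neg_smul]
  · intro l r h h'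
    rw [cSum_nd_apply_eq_zero hA hz hab (by rw [BT.nodes]; omega) (Ne.symm h'), zero_smul]

lemma expandL_succ {m : ℕ} (hL : ∀ k ≤ m, ExpandL k) (hR : ∀ k ≤ m, ExpandR k) :
    ExpandL (m + 1) := by
  intro a v hv hn ha
  obtain ⟨b, hb, hmax⟩ := exists_max_mem (v := v) (by rintro rfl; simp at hv)
  have hA : (a :: v).Nodup := List.nodup_cons.2 ⟨fun h => lt_irrefl _ (ha a h), hn⟩
  have key := shSum_cons_eq_zero (b := b) (L := v)
    (h := fun w => ∑ t ∈ allBT (m + 1), cSum t (a :: v) (a :: w) • coeffL t - fund w) ?_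
  · obtain ⟨v₁, u₁, rfl⟩ := List.append_of_mem hb
    exact sub_eq_zero.1 (key v₁ u₁ (List.Perm.refl _))
  intro u v' hp
  have hlen : v'.length + u.length = m := by
    have := hp.length_eq
    simp at this; omega
  have hz : (a :: v).Perm (u.reverse ++ b :: a :: v') := by
    simp only [List.perm_iff_count, List.count_append, List.count_cons,
      List.count_reverse] at hp ⊢
    intro c
    have := hp c
    omega
  have hab : ∀ x ∈ a :: v, a ≤ x ∧ x ≤ b := by
    intro x hx
    rcases List.mem_cons.1 hx with rfl | hx
    · exact ⟨le_rfl, (ha b hb).le⟩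
    · exact ⟨(ha x hx).le, hmax x hx⟩
  have hnd := hp.nodup hn
  have hbu : ∀ x ∈ u, ltSign false b x := fun x hx => by
    have h1 := hmax x (hp.symm.subset (by simp [hx]))
    have h2 : x ≠ b := by
      rintro rfl
      simp [hx] at hnd
    simp only [ltSign]
    exact lt_of_le_of_ne h1 h2
  rw [shSum_sub, shSum_sum, shSum_fund _ _ hnd, ← consQ_fund _ _ _ hbu, sub_eq_zero]
  have step : ∀ t ∈ allBT (m + 1), shSum (fun w => cSum t (a :: v) (a :: w) • coeffL t) (b :: u) v'
      = cSum t (a :: v) (u.reverse ++ b :: a :: v') • ((-1 : ℚ) ^ (u.length + 1) • coeffL t) := by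
    intro t ht
    have := (isLieFun_cSum (t := t) (L := a :: v) (by
      rw [mem_allBT.1 ht]; simp [hv])).apply_middle (u.reverse ++ [b]) a v'
    simp only [List.append_assoc, List.cons_append, List.nil_append, List.length_append,
      List.length_reverse, List.length_singleton, List.reverse_append, List.reverse_reverse,
      List.reverse_singleton] at this
    rw [shSum_smul_const, this, smul_smul, mul_right_comm, neg_one_pow_mul_self, one_mul]
  rw [Finset.sum_congr rfl step]
  have := sum_cSum_smul (c := fun t => (-1 : ℚ) ^ (u.length + 1) • coeffL t)
    (E := (-1 : ℚ) • (consQ false ∘ₗ revQ)) (F := LinearMap.id) hA hz hab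
    (hL _ (by omega)) (hR _ (by simp; omega)) ?_
  · simp only [List.length_reverse, hlen] at this
    rw [this]
    simp [revQ_fund]
  · intro l r _ hr
    rw [List.length_reverse] at hr
    rw [coeffL, hr, smul_smul, pow_succ, mul_right_comm, neg_one_pow_mul_self]
    simp

lemma expandR_succ {m : ℕ} (hL : ∀ k ≤ m, ExpandL k) (hR : ∀ k ≤ m, ExpandR k) :
    ExpandR (m + 1) := by
  intro b u hu hn hb
  obtain ⟨a, ha, hmin⟩ := exists_min_mem (v := u) (by rintro rfl; simp at hu)
  have hA : (u ++ [b]).Nodup := by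
    rw [List.nodup_append]
    refine ⟨hn, by simp, ?_⟩
    rintro x hx y hy rfl
    rw [List.mem_singleton] at hy
    exact (hb x hx).ne hy
  have key := shSum_snoc_eq_zero (a := a) (L := u)
    (h := fun w => ∑ t ∈ allBT (m + 1), cSum t (u ++ [b]) (w ++ [b]) • coeffR t - fund w) ?_
  · obtain ⟨v₁, u₁, rfl⟩ := List.append_of_mem ha
    exact sub_eq_zero.1 (key v₁ u₁ (List.Perm.refl _))
  intro u' v hp
  have hlen : v.length + u'.length = m := by
    have := hp.length_eq
    simp at this; omega
  have hz : (u ++ [b]).Perm (u' ++ b :: a :: v.reverse) := by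
    simp only [List.perm_iff_count, List.count_append, List.count_cons, List.count_nil,
      List.count_reverse] at hp ⊢
    intro c
    have := hp c
    omega
  have hab : ∀ x ∈ u ++ [b], a ≤ x ∧ x ≤ b := by
    intro x hx
    rcases List.mem_append.1 hx with hx | hx
    · exact ⟨hmin x hx, (hb x hx).le⟩
    · rw [List.mem_singleton.1 hx]
      exact ⟨(hb a ha).le, le_rfl⟩
  have hnd := hp.nodup hn
  have hav : ∀ x ∈ v.reverse, ltSign true a x := fun x hx => by
    rw [List.mem_reverse] at hx
    have h1 := hmin x (hp.symm.subset (by simp [hx]))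
    have h2 : x ≠ a := by
      rintro rfl
      simp only [List.nodup_append, List.mem_singleton] at hnd
      exact hnd.2.1.2.2 x hx x rfl rfl
    simp only [ltSign]
    exact lt_of_le_of_ne h1 h2.symm
  have hrev : fund (v ++ [a]) = revQ (consQ true (fund v.reverse)) := by
    rw [consQ_fund _ _ _ hav, revQ_fund]; simp
  rw [shSum_sub, shSum_sum, shSum_fund _ _ hnd, hrev, sub_eq_zero]
  have step : ∀ t ∈ allBT (m + 1),
      shSum (fun w => cSum t (u ++ [b]) (w ++ [b]) • coeffR t) u' (v ++ [a])
      = cSum t (u ++ [b]) (u' ++ b :: a :: v.reverse) •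
        ((-1 : ℚ) ^ (v.length + 1) • coeffR t) := by
    intro t ht
    have := (isLieFun_cSum (t := t) (L := u ++ [b]) (by
      rw [mem_allBT.1 ht]; simp [hu])).apply_middle' u' b (a :: v.reverse)
    simp only [List.length_cons, List.length_reverse, List.reverse_cons,
      List.reverse_reverse] at this
    rw [shSum_smul_const, this, smul_smul, mul_right_comm, neg_one_pow_mul_self, one_mul]
  rw [Finset.sum_congr rfl step]
  have := sum_cSum_smul (c := fun t => (-1 : ℚ) ^ (v.length + 1) • coeffR t)
    (E := (-1 : ℚ) • LinearMap.id) (F := revQ ∘ₗ consQ true) hA hz hab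
    (hL _ (by simp; omega)) (hR _ (by omega)) ?_
  · simp only [List.length_reverse, hlen] at this
    rw [this]
    simp
  · intro l r hl _
    rw [List.length_reverse] at hl
    rw [coeffR, hl, smul_smul, pow_succ, mul_right_comm, neg_one_pow_mul_self]
    simp

lemma expandL_expandR (m : ℕ) : ExpandL m ∧ ExpandR m := by
  induction m using Nat.strong_induction_on with
  | _ m ih =>
    cases m with
    | zero =>
      refine ⟨fun a v hv _ _ => ?_, fun b u hu _ _ => ?_⟩
      · rw [List.length_eq_zero_iff.1 hv, sum_cSum_nil, coeffL, fund_nil]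
      · rw [List.length_eq_zero_iff.1 hu, List.nil_append, sum_cSum_nil, coeffR, fund_nil]
    | succ m =>
      have hL : ∀ k ≤ m, ExpandL k := fun k hk => (ih k (by omega)).1
      have hR : ∀ k ≤ m, ExpandR k := fun k hk => (ih k (by omega)).2
      exact ⟨expandL_succ hL hR, expandR_succ hL hR⟩

/-! ### Invariance of the expansion coefficients under moves -/

mutual
lemma LIn.invariant {t t' : BT} : LIn t t' → t.nodes = t'.nodes ∧ coeffR t = coeffR t'
  | .here t1 t2 t3 => by
    refine ⟨by simp only [BT.nodes]; omega, ?_⟩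
    simp only [coeffR, smul_mul_assoc]
    rw [smul_comm, mul_right_comm]
  | .congL r h => by
    obtain ⟨h1, h2⟩ := h.invariant
    simp only [BT.nodes, coeffR, h1, h2, and_self]
  | .congR l h => by
    obtain ⟨h1, h2⟩ := h.invariant
    simp only [BT.nodes, coeffR, h1, h2, and_self]

lemma LSub.invariant {t t' : BT} : LSub t t' → t.nodes = t'.nodes ∧ coeffL t = coeffL t'
  | .congL r h => by
    obtain ⟨h1, h2⟩ := h.invariant
    simp only [BT.nodes, coeffL, h1, h2, and_self]
  | .congR l h => by
    obtain ⟨h1, h2⟩ := h.invariant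
    simp only [BT.nodes, coeffL, h1, h2, and_self]
end

mutual
lemma RIn.invariant {t t' : BT} : RIn t t' → t.nodes = t'.nodes ∧ coeffL t = coeffL t'
  | .here t1 t2 t3 => by
    refine ⟨by simp only [BT.nodes]; omega, ?_⟩
    simp only [coeffL, mul_smul_comm]
    rw [smul_comm, mul_left_comm]
  | .congL r h => by
    obtain ⟨h1, h2⟩ := h.invariant
    simp only [BT.nodes, coeffL, h1, h2, and_self]
  | .congR l h => by
    obtain ⟨h1, h2⟩ := h.invariant
    simp only [BT.nodes, coeffL, h1, h2, and_self]

lemma RSub.invariant {t t' : BT} : RSub t t' → t.nodes = t'.nodes ∧ coeffR t = coeffR t'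
  | .congL r h => by
    obtain ⟨h1, h2⟩ := h.invariant
    simp only [BT.nodes, coeffR, h1, h2, and_self]
  | .congR l h => by
    obtain ⟨h1, h2⟩ := h.invariant
    simp only [BT.nodes, coeffR, h1, h2, and_self]
end

/-! ### The two ways of computing the coefficients agree -/

/-- The span of the fundamental functions of the rearrangements of a word. -/
def fundSpan (L : List ℕ) : Submodule ℚ QFun :=
  Submodule.span ℚ {f | ∃ w : List ℕ, w.Perm L ∧ f = fund w}

lemma fund_mem_fundSpan {w L : List ℕ} (h : w.Perm L) : fund w ∈ fundSpan L :=
  Submodule.subset_span ⟨w, h, rfl⟩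

lemma bilin_eq_of_fund {M : Type*} [AddCommGroup M] [Module ℚ M] {B B' : QFun →ₗ[ℚ] QFun →ₗ[ℚ] M}
    {U V : List ℕ} (h : ∀ u v : List ℕ, u.Perm U → v.Perm V → B (fund u) (fund v)
      = B' (fund u) (fund v)) {x y : QFun} (hx : x ∈ fundSpan U) (hy : y ∈ fundSpan V) :
    B x y = B' x y := by
  refine LinearMap.eqOn_span (f := B.flip y) (g := B'.flip y) ?_ hx
  rintro _ ⟨u, hu, rfl⟩
  refine LinearMap.eqOn_span (f := B (fund u)) (g := B' (fund u)) ?_ hy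
  rintro _ ⟨v, hv, rfl⟩
  exact h u v hu hv

lemma mul_mem_fundSpan {E F : QFun →ₗ[ℚ] QFun} {U V L : List ℕ}
    (h : ∀ u v : List ℕ, u.Perm U → v.Perm V → E (fund u) * F (fund v) ∈ fundSpan L)
    {x y : QFun} (hx : x ∈ fundSpan U) (hy : y ∈ fundSpan V) : E x * F y ∈ fundSpan L := by
  have := bilin_eq_of_fund (U := U) (V := V) (x := x) (y := y)
    (B := ((LinearMap.mul ℚ QFun).compl₁₂ E F).compr₂ (fundSpan L).mkQ) (B' := 0) ?_ hx hy
  · simpa using this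
  · intro u v hu hv
    simpa using h u v hu hv

lemma shSum_fund_mem {L u v : List ℕ} (h : (u ++ v).Perm L) : shSum fund u v ∈ fundSpan L := by
  refine list_sum_mem fun x hx => ?_
  obtain ⟨w, hw, rfl⟩ := List.mem_map.1 hx
  exact fund_mem_fundSpan ((perm_of_mem_sh hw).trans h)

lemma exists_split_perm {L : List ℕ} {b p q : ℕ} (hb : b ∈ L) (hL : L.length = p + q + 1) :
    ∃ U V : List ℕ, U.length = p ∧ V.length = q ∧ L.Perm (b :: U ++ V) := by
  have hlen := List.length_erase_of_mem hb
  refine ⟨(L.erase b).take p, (L.erase b).drop p, by simp; omega, by simp; omega, ?_⟩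
  rw [List.cons_append, List.take_append_drop]
  exact List.perm_cons_erase hb

lemma fund_cons_reverse {b : ℕ} {u : List ℕ} (h : ∀ x ∈ u, x < b) :
    fund (b :: u.reverse) = consQ false (revQ (fund u)) := by
  rw [revQ_fund, consQ_fund]
  intro x hx
  exact h x (List.mem_reverse.1 hx)

lemma fund_reverse_snoc {a : ℕ} {v : List ℕ} (h : ∀ x ∈ v, a < x) :
    fund (v.reverse ++ [a]) = revQ (consQ true (fund v)) := by
  rw [consQ_fund true a v h, revQ_fund, List.reverse_cons]

lemma coeff_mem_fundSpan (t : BT) {L : List ℕ} (hn : L.Nodup) (hL : L.length = t.nodes) :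
    coeffL t ∈ fundSpan L ∧ coeffR t ∈ fundSpan L := by
  induction t generalizing L with
  | nil =>
    rw [List.length_eq_zero_iff.1 hL, coeffL, coeffR, ← fund_nil]
    exact ⟨fund_mem_fundSpan (List.Perm.refl _), fund_mem_fundSpan (List.Perm.refl _)⟩
  | nd l r hl hr =>
    rw [BT.nodes] at hL
    have hne : L ≠ [] := by rintro rfl; simp at hL
    rw [coeffL, coeffR]
    constructor
    · obtain ⟨b, hb, hmax⟩ := exists_max_mem hne
      obtain ⟨U, V, hU, hV, hp⟩ := exists_split_perm (p := r.nodes) (q := l.nodes) hb (by omega)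
      have hn' := hp.nodup hn
      have hUV := (List.nodup_cons.1 hn').2
      refine Submodule.smul_mem _ _ (mul_mem_fundSpan (E := consQ false ∘ₗ revQ)
        (F := LinearMap.id) (fun u v hu hv => ?_) (hr (List.nodup_append.1 hUV).1 hU).2
        (hl (List.nodup_append.1 hUV).2.1 hV).1)
      have hp' : (b :: u.reverse ++ v).Perm L :=
        ((((List.reverse_perm u).trans hu).cons b).append hv).trans hp.symm
      rw [LinearMap.comp_apply, LinearMap.id_apply, ← fund_cons_reverse (b := b),
        ← shSum_fund _ _ (hp'.symm.nodup hn)]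
      · exact shSum_fund_mem hp'
      · intro x hx
        have hx' := hu.subset hx
        refine lt_of_le_of_ne (hmax x (hp.symm.subset (by simp [hx']))) ?_
        rintro rfl
        exact (List.nodup_cons.1 hn').1 (List.mem_append_left _ hx')
    · obtain ⟨a, ha, hmin⟩ := exists_min_mem hne
      obtain ⟨V, U, hV, hU, hp⟩ := exists_split_perm (p := l.nodes) (q := r.nodes) ha (by omega)
      have hn' := hp.nodup hn
      have hUV := (List.nodup_cons.1 hn').2
      refine Submodule.smul_mem _ _ (mul_mem_fundSpan (E := LinearMap.id)
        (F := revQ ∘ₗ consQ true) (fun u v hu hv => ?_) (hr (List.nodup_append.1 hUV).2.1 hU).2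
        (hl (List.nodup_append.1 hUV).1 hV).1)
      have hp' : (u ++ (v.reverse ++ [a])).Perm L := by
        simp only [List.perm_iff_count, List.count_append, List.count_cons, List.count_nil,
          List.count_reverse] at hp hu hv ⊢
        intro c
        have h1 := hp c
        have h2 := hu c
        have h3 := hv c
        omega
      rw [LinearMap.comp_apply, LinearMap.id_apply, ← fund_reverse_snoc (a := a),
        ← shSum_fund _ _ (hp'.symm.nodup hn)]
      · exact shSum_fund_mem hp'
      · intro x hx
        have hx' := hv.subset hx
        refine lt_of_le_of_ne (hmin x (hp.symm.subset (by simp [hx']))) ?_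
        rintro rfl
        exact (List.nodup_cons.1 hn').1 (List.mem_append_left _ hx')

section functional

variable {ℓ : QFun →ₗ[ℚ] ℚ} {f : List ℕ → ℚ} {L : List ℕ}

/-- `f` is the Lie function on the rearrangements of `L` represented by the functional `ℓ`. -/
def Represents (ℓ : QFun →ₗ[ℚ] ℚ) (f : List ℕ → ℚ) (L : List ℕ) : Prop :=
  IsLieFun f ∧ ∀ w : List ℕ, w.Perm L → f w = ℓ (fund w)

lemma lt_of_perm_middle {u v : List ℕ} {a b : ℕ} (hL : L.Nodup)
    (hz : L.Perm (u ++ b :: a :: v)) (hab : ∀ x ∈ L, a ≤ x ∧ x ≤ b) :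
    a < b ∧ (∀ x ∈ u, a < x ∧ x < b) ∧ ∀ x ∈ v, a < x ∧ x < b := by
  have hN := hz.nodup hL
  simp only [List.nodup_append, List.nodup_cons, List.mem_cons, not_or] at hN
  obtain ⟨-, ⟨⟨h1, h2⟩, h3, -⟩, h4⟩ := hN
  have hab' := hab b (hz.symm.subset (by simp))
  refine ⟨by omega, fun x hx => ?_, fun x hx => ?_⟩
  · have := hab x (hz.symm.subset (by simp [hx]))
    have h5 := h4 x hx a (by simp)
    have h6 := h4 x hx b (by simp)
    omega
  · have := hab x (hz.symm.subset (by simp [hx]))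
    have h5 : x ≠ a := by rintro rfl; exact h3 hx
    have h6 : x ≠ b := by rintro rfl; exact h2 hx
    omega

lemma Represents.apply_left (h : Represents ℓ f L) (hL : L.Nodup) {u v : List ℕ} {a b : ℕ}
    (hz : L.Perm (u ++ b :: a :: v)) (hab : ∀ x ∈ L, a ≤ x ∧ x ≤ b) :
    ℓ (consQ true (consQ false (revQ (fund u)) * fund v))
      = (-1) ^ (u.length + 1) * f (u ++ b :: a :: v) := by
  obtain ⟨h1, h2, h3⟩ := lt_of_perm_middle hL hz hab
  have hp : (a :: (b :: u.reverse ++ v)).Perm L := by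
    simp only [List.perm_iff_count, List.count_append, List.count_cons,
      List.count_reverse] at hz ⊢
    intro c
    have := hz c
    omega
  have hn := (List.nodup_cons.1 (hp.symm.nodup hL)).2
  have e := h.1.apply_middle (u ++ [b]) a v
  simp only [List.append_assoc, List.cons_append, List.nil_append, List.length_append,
    List.length_singleton, List.reverse_append, List.reverse_singleton] at e
  rw [e, ← mul_assoc, neg_one_pow_mul_self, one_mul, ← fund_cons_reverse fun x hx => (h2 x hx).2,
    ← shSum_fund _ _ hn]
  have := shSum_map (ℓ ∘ₗ consQ true).toAddMonoidHom fund (b :: u.reverse) v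
  simp only [LinearMap.toAddMonoidHom_coe, LinearMap.comp_apply] at this
  rw [← this]
  refine shSum_congr fun w hw => ?_
  rw [consQ_fund true a w, h.2 _ ((hw.cons a).trans hp)]
  intro x hx
  have := hw.subset hx
  simp only [List.cons_append, List.mem_cons, List.mem_append, List.mem_reverse] at this
  rcases this with rfl | hx | hx
  exacts [h1, (h2 x hx).1, (h3 x hx).1]

lemma Represents.apply_right (h : Represents ℓ f L) (hL : L.Nodup) {u v : List ℕ} {a b : ℕ}
    (hz : L.Perm (u ++ b :: a :: v)) (hab : ∀ x ∈ L, a ≤ x ∧ x ≤ b) :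
    ℓ (revQ (consQ false (revQ (fund u * revQ (consQ true (fund v))))))
      = (-1) ^ (v.length + 1) * f (u ++ b :: a :: v) := by
  obtain ⟨h1, h2, h3⟩ := lt_of_perm_middle hL hz hab
  have hp : ((u ++ (v.reverse ++ [a])) ++ [b]).Perm L := by
    simp only [List.perm_iff_count, List.count_append, List.count_cons, List.count_nil,
      List.count_reverse] at hz ⊢
    intro c
    have := hz c
    omega
  have hn := (List.nodup_append.1 (hp.symm.nodup hL)).1
  have e := h.1.apply_middle' u b (a :: v)
  rw [List.length_cons, List.reverse_cons] at e
  rw [e, ← mul_assoc, neg_one_pow_mul_self, one_mul, ← fund_reverse_snoc fun x hx => (h3 x hx).1,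
    ← shSum_fund _ _ hn]
  have := shSum_map (ℓ ∘ₗ revQ ∘ₗ consQ false ∘ₗ revQ).toAddMonoidHom fund u (v.reverse ++ [a])
  simp only [LinearMap.toAddMonoidHom_coe, LinearMap.comp_apply] at this
  rw [← this]
  refine shSum_congr fun w hw => ?_
  rw [h.2 _ ((hw.append_right [b]).trans hp), ← fund_cons_reverse (b := b), revQ_fund]
  · simp
  intro x hx
  have := hw.subset hx
  simp only [List.mem_append, List.mem_reverse, List.mem_singleton] at this
  rcases this with hx | hx | rfl
  exacts [(h2 x hx).2, (h3 x hx).2, h1]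

/-- The coefficient of `c_t` computed from words starting with their smallest letter. -/
noncomputable def liftL (ℓ : QFun →ₗ[ℚ] ℚ) (t : BT) : ℚ := ℓ (consQ true (coeffL t))

/-- The coefficient of `c_t` computed from words ending with their largest letter. -/
noncomputable def liftR (ℓ : QFun →ₗ[ℚ] ℚ) (t : BT) : ℚ :=
  ℓ (revQ (consQ false (revQ (coeffR t))))

lemma Represents.liftL_eq_liftR {n : ℕ} (h : Represents ℓ f (List.range' 1 n)) {t : BT}
    (ht : t.nodes + 1 = n) : liftL ℓ t = liftR ℓ t := by
  cases t with
  | nil =>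
    rw [liftL, liftR, coeffL, coeffR, ← fund_nil, revQ_fund, List.reverse_nil,
      consQ_fund true 1 [] (by simp), consQ_fund false 1 [] (by simp), revQ_fund]
    rfl
  | nd l r =>
    rw [BT.nodes] at ht
    set U := List.range' (2 + l.nodes) r.nodes with hU
    set V := List.range' 2 l.nodes with hV
    have hL : (List.range' 1 n).Nodup := List.nodup_range'
    have hab : ∀ x ∈ List.range' 1 n, 1 ≤ x ∧ x ≤ n := fun x hx => by
      rw [List.mem_range'_1] at hx
      omega
    have hUV : (List.range' 1 n).Perm (U ++ n :: 1 :: V) := by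
      rw [← ht, List.range'_1_concat, List.range'_succ, ← List.range'_append_1, ← hU, ← hV]
      have : l.nodes + r.nodes + 1 + 1 = 1 + (l.nodes + r.nodes + 1) := by omega
      simp only [List.perm_iff_count, List.count_append, List.count_cons, List.count_nil, this]
      intro c
      omega
    have key := bilin_eq_of_fund (U := U) (V := V) (x := coeffR r) (y := coeffL l)
      (B := ((-1 : ℚ) ^ r.nodes) • ((LinearMap.mul ℚ QFun).compl₁₂ (consQ false ∘ₗ revQ)
        LinearMap.id).compr₂ (ℓ ∘ₗ consQ true))
      (B' := ((-1 : ℚ) ^ l.nodes) • ((LinearMap.mul ℚ QFun).compl₁₂ LinearMap.id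
        (revQ ∘ₗ consQ true)).compr₂ (ℓ ∘ₗ revQ ∘ₗ consQ false ∘ₗ revQ)) ?_
      (coeff_mem_fundSpan r List.nodup_range' (by simp)).2
      (coeff_mem_fundSpan l List.nodup_range' (by simp)).1
    · simpa [liftL, liftR, coeffL, coeffR] using key
    · intro u v hu hv
      have hz := hUV.trans (hu.symm.append ((hv.symm.cons 1).cons n))
      have h1 := h.apply_left hL hz hab
      have h2 := h.apply_right hL hz hab
      have lu : u.length = r.nodes := by rw [hu.length_eq]; simp [hU]
      have lv : v.length = l.nodes := by rw [hv.length_eq]; simp [hV]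
      simp only [LinearMap.smul_apply, LinearMap.compr₂_apply, LinearMap.compl₁₂_apply,
        LinearMap.comp_apply, LinearMap.id_apply, LinearMap.mul_apply', h1, h2, lu, lv,
        smul_eq_mul]
      rw [pow_succ, pow_succ, ← mul_assoc, ← mul_assoc, ← mul_assoc, ← mul_assoc,
        neg_one_pow_mul_self, neg_one_pow_mul_self]

lemma Represents.liftL_eq_of_LREquiv {n : ℕ} (h : Represents ℓ f (List.range' 1 n)) {t t' : BT}
    (ht : LREquiv t t') : t.nodes = t'.nodes ∧ (t.nodes + 1 = n → liftL ℓ t = liftL ℓ t') := by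
  induction ht with
  | rel t t' ht =>
    rcases ht with ht | ht
    · obtain ⟨h1, h2⟩ := ht.invariant
      refine ⟨h1, fun hn => ?_⟩
      rw [h.liftL_eq_liftR hn, h.liftL_eq_liftR (h1 ▸ hn), liftR, liftR, h2]
    · obtain ⟨h1, h2⟩ := ht.invariant
      exact ⟨h1, fun _ => by rw [liftL, liftL, h2]⟩
  | refl t => exact ⟨rfl, fun _ => rfl⟩
  | symm t t' _ ih => exact ⟨ih.1.symm, fun hn => (ih.2 (by rw [ih.1, hn])).symm⟩
  | trans t t' t'' _ _ ih ih' =>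
    exact ⟨ih.1.trans ih'.1, fun hn => (ih.2 hn).trans (ih'.2 (ih.1 ▸ hn))⟩

end functional

/-! ### Lie elements in the descent subspace -/

lemma mem_permWords {n : ℕ} {w : List ℕ} : w ∈ permWords n ↔ w.Perm (List.range' 1 n) :=
  mem_rearrangements

lemma isLieFun_of_mem_LieN {n : ℕ} {x : FW ℚ} (hx : x ∈ LieN n) :
    IsLieFun x ∧ ∀ w, x w ≠ 0 → w.Perm (List.range' 1 n) := by
  induction hx using Submodule.span_induction with
  | mem x h =>
    obtain ⟨t, w, hw, ht, rfl⟩ := h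
    rw [mem_permWords] at hw
    have hl : w.length = t.nodes + 1 := by rw [hw.length_eq]; simp [ht]
    exact ⟨isLieFun_evalBT hl, fun z hz => (perm_of_evalBT_ne_zero hl hz).trans hw⟩
  | zero => exact ⟨IsLieFun.zero, fun w h => absurd rfl h⟩
  | add x y _ _ hx hy =>
    refine ⟨hx.1.add hy.1, fun w h => ?_⟩
    by_cases h' : x w = 0
    · exact hy.2 w fun h'' => h (by rw [Finsupp.add_apply, h', h'', add_zero])
    · exact hx.2 w h'
  | smul c x _ hx =>
    refine ⟨hx.1.smul c, fun w h => hx.2 w fun h' => h ?_⟩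
    rw [Finsupp.smul_apply, h', smul_zero]

lemma IsLieFun.eq_of_cons {f g : List ℕ → ℚ} (hf : IsLieFun f) (hg : IsLieFun g) {a : ℕ}
    {L : List ℕ} (h : ∀ w : List ℕ, (a :: w).Perm (a :: L) → f (a :: w) = g (a :: w))
    (hf' : ∀ w, f w ≠ 0 → w.Perm (a :: L)) (hg' : ∀ w, g w ≠ 0 → w.Perm (a :: L)) : f = g := by
  funext w
  by_cases hw : w.Perm (a :: L)
  · obtain ⟨u, v, rfl⟩ := List.append_of_mem (hw.symm.subset (List.mem_cons_self ..))
    rw [hf.apply_middle, hg.apply_middle]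
    congr 1
    refine shSum_congr fun z hz => h z ?_
    refine (hz.cons a).trans (List.Perm.trans ?_ hw)
    exact (((List.reverse_perm u).append_right v).cons a).trans List.perm_middle.symm
  · rw [not_not.1 (mt (hf' w) hw), not_not.1 (mt (hg' w) hw)]

lemma desPat_eq_map (w : List ℕ) :
    desPat w = (List.range (w.length - 1)).map fun i => decide (i + 1 ∈ desSet w) := by
  have h1 : ∀ w : List ℕ, desPat w
      = (List.range (w.length - 1)).map fun i => decide (w.getD (i + 1) 0 < w.getD i 0) := by
    intro w
    induction w with
    | nil => rfl
    | cons a w ih =>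
      cases w with
      | nil => rfl
      | cons b w =>
        rw [desPat, ih]
        simp [List.range_succ_eq_map, Function.comp_def]
  rw [h1]
  refine List.map_congr_left fun i hi => ?_
  rw [List.mem_range] at hi
  simp only [desSet, Finset.mem_filter, Finset.mem_Icc, Nat.add_sub_cancel, decide_eq_decide]
  constructor
  · exact fun h => ⟨⟨by omega, by omega⟩, h⟩
  · exact fun h => h.2

lemma desSet_eq_iff {w : List ℕ} {E : Finset ℕ} (hE : E ⊆ Finset.Icc 1 (w.length - 1)) :
    desSet w = E ↔ desPat w = (List.range (w.length - 1)).map fun i => decide (i + 1 ∈ E) := by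
  rw [desPat_eq_map]
  constructor
  · rintro rfl
    rfl
  · intro h
    rw [List.map_inj_left] at h
    have hs : desSet w ⊆ Finset.Icc 1 (w.length - 1) := Finset.filter_subset _ _
    have key (i : ℕ) (hi : i ∈ Finset.Icc 1 (w.length - 1)) : i ∈ desSet w ↔ i ∈ E := by
      rw [Finset.mem_Icc] at hi
      have := h (i - 1) (by rw [List.mem_range]; omega)
      rwa [decide_eq_decide, Nat.sub_add_cancel hi.1] at this
    ext i
    exact ⟨fun hi => (key i (hs hi)).1 hi, fun hi => (key i (hE hi)).2 hi⟩

lemma exists_functional_of_mem_span {n : ℕ} (hn : 1 ≤ n) {x : FW ℚ}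
    (hx : x ∈ Submodule.span ℚ ((fun E => DE n E) '' {E | E ⊆ Finset.Icc 1 (n - 1)})) :
    ∃ ℓ : QFun →ₗ[ℚ] ℚ, ∀ w : List ℕ, w.Perm (List.range' 1 n) → x w = ℓ (fund w) := by
  induction hx using Submodule.span_induction with
  | mem x h =>
    obtain ⟨E, hE, rfl⟩ := h
    obtain ⟨ℓ, h⟩ := exists_functional ((List.range (n - 1)).map fun i => decide (i + 1 ∈ E)) 0
    refine ⟨ℓ, fun w hw => ?_⟩
    have hl : w.length = n := by rw [hw.length_eq]; simp
    rw [h w (hw.symm.nodup List.nodup_range') (by simp; omega)]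
    subst hl
    simp only [DE, Finsupp.finsetSum_apply, Finsupp.single_apply, List.replicate_zero,
      List.nil_append, ← desSet_eq_iff hE]
    rw [Finset.sum_ite_eq']
    simp [mem_permWords, hw]
  | zero => exact ⟨0, fun _ _ => rfl⟩
  | add x y _ _ hx hy =>
    obtain ⟨ℓ, h⟩ := hx
    obtain ⟨ℓ', h'⟩ := hy
    exact ⟨ℓ + ℓ', fun w hw => by
      rw [Finsupp.add_apply, h w hw, h' w hw, LinearMap.add_apply]⟩
  | smul c x _ hx =>
    obtain ⟨ℓ, h⟩ := hx
    exact ⟨c • ℓ, fun w hw => by rw [Finsupp.smul_apply, h w hw, LinearMap.smul_apply]⟩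

lemma cElt_mem_LieN (t : BT) : cElt t ∈ LieN (t.nodes + 1) :=
  Submodule.sum_mem _ fun w hw =>
    Submodule.subset_span ⟨t, w, (Finset.mem_filter.1 hw).1, rfl, rfl⟩

lemma Represents.eq_sum {ℓ : QFun →ₗ[ℚ] ℚ} {m : ℕ} {x : FW ℚ} (hx : x ∈ LieN (m + 1))
    (h : Represents ℓ x (List.range' 1 (m + 1))) :
    x = ∑ t ∈ allBT m, liftL ℓ t • cElt t := by
  have hy : ∑ t ∈ allBT m, liftL ℓ t • cElt t ∈ LieN (m + 1) :=
    Submodule.sum_mem _ fun t ht => Submodule.smul_mem _ _ (mem_allBT.1 ht ▸ cElt_mem_LieN t)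
  obtain ⟨hx1, hx2⟩ := isLieFun_of_mem_LieN hx
  obtain ⟨hy1, hy2⟩ := isLieFun_of_mem_LieN hy
  refine DFunLike.coe_injective (hx1.eq_of_cons hy1 (fun w hw => ?_) hx2 hy2)
  have hw' := (List.perm_cons 1).1 hw
  have hlt : ∀ z ∈ w, 1 < z := fun z hz => by
    have := hw'.subset hz
    rw [List.mem_range'_1] at this
    omega
  have hlen : w.length = m := by rw [hw'.length_eq]; simp
  rw [h.2 _ hw, ← consQ_fund true 1 w hlt,
    ← (expandL_expandR m).1 1 w hlen (hw'.symm.nodup List.nodup_range') hlt,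
    Finsupp.finsetSum_apply, map_sum, map_sum]
  refine Finset.sum_congr rfl fun t ht => ?_
  rw [map_smul, map_smul, Finsupp.smul_apply, smul_eq_mul, smul_eq_mul, mul_comm, liftL,
    cElt_eq_cSum, mem_allBT.1 ht, cSum_congr t hw]
  rfl

open scoped Classical in
lemma sum_smul_cElt_mem {m : ℕ} {b : BT → ℚ}
    (hb : ∀ t t', LREquiv t t' → t.nodes = m → b t = b t') :
    ∑ t ∈ allBT m, b t • cElt t
      ∈ Submodule.span ℚ {y : FW ℚ | ∃ t : BT, t.nodes = m ∧ y = LRclassSum t} := by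
  set C : BT → Finset BT := fun t => (allBT m).filter fun s => LREquiv t s with hC
  have symm {t t' : BT} (h : LREquiv t t') : LREquiv t' t := Relation.EqvGen.symm _ _ h
  have hCeq {t t' : BT} (h : LREquiv t t') : C t = C t' :=
    Finset.filter_congr fun s _ =>
      ⟨fun h' => (symm h).trans _ _ _ h', fun h' => h.trans _ _ _ h'⟩
  have key : ∑ t ∈ allBT m, b t • cElt t
      = ∑ t ∈ allBT m, (b t / (C t).card) • (LRclassSum t : FW ℚ) := by
    have e : ∀ t ∈ allBT m, (b t / (C t).card) • (LRclassSum t : FW ℚ)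
        = ∑ s ∈ C t, (b t / (C t).card) • (cElt s : FW ℚ) := fun t ht => by
      rw [LRclassSum, mem_allBT.1 ht, Finset.smul_sum]
    rw [Finset.sum_congr rfl e, Finset.sum_comm' (s' := C) (t' := allBT m)]
    · refine Finset.sum_congr rfl fun s hs => ?_
      have e' : ∀ t ∈ C s, (b t / (C t).card) • (cElt s : FW ℚ)
          = (b s / (C s).card) • (cElt s : FW ℚ) := fun t ht => by
        have h := (Finset.mem_filter.1 ht).2
        rw [hCeq h, hb s t h (mem_allBT.1 hs)]
      have hne : ((C s).card : ℚ) ≠ 0 := by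
        rw [Nat.cast_ne_zero]
        exact Finset.card_ne_zero_of_mem
          (Finset.mem_filter.2 ⟨hs, Relation.EqvGen.refl s⟩)
      rw [Finset.sum_congr rfl e', Finset.sum_const, ← Nat.cast_smul_eq_nsmul ℚ, smul_smul,
        mul_div_cancel₀ _ hne]
    · intro t s
      simp only [hC, Finset.mem_filter]
      exact ⟨fun h => ⟨⟨h.1, symm h.2.2⟩, h.2.1⟩, fun h => ⟨h.1.1, h.2, symm h.1.2⟩⟩
  rw [key]
  exact Submodule.sum_mem _ fun t ht => Submodule.smul_mem _ _
    (Submodule.subset_span ⟨t, mem_allBT.1 ht, rfl⟩)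

theorem stmt19 : ∀ n : ℕ, 1 ≤ n → ∀ x : FW ℚ, x ∈ LieN n →
    x ∈ Submodule.span ℚ ((fun E => DE n E) '' {E | E ⊆ Finset.Icc 1 (n - 1)}) →
    x ∈ Submodule.span ℚ {y : FW ℚ | ∃ t : BT, t.nodes = n - 1 ∧ y = LRclassSum t} := by
  intro n hn x hx hD
  obtain ⟨m, rfl⟩ := Nat.exists_eq_add_of_le' hn
  obtain ⟨ℓ, h⟩ := exists_functional_of_mem_span hn hD
  have hℓ : Represents ℓ x (List.range' 1 (m + 1)) := ⟨(isLieFun_of_mem_LieN hx).1, h⟩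
  rw [hℓ.eq_sum hx]
  exact sum_smul_cElt_mem fun t t' ht hm => (hℓ.liftL_eq_of_LREquiv ht).2 (congrArg (· + 1) hm)
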